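/- arXiv:2007.02098 — 3 statements merged into one kernel-verified Lean document; each statement's English description precedes it below -/
import Mathlib

section
/- Let 0 < ν < 1 and s ∈ ℝ. Then ∫_0^∞ e^{-s x} · M_ν(x) dx = E_ν(-s), where E_ν is the Mittag-Leffler function with one parameter. -/
/-- The Wright function `W_{λ,μ}(x) = ∑ xⁿ/(n!·Γ(λn+μ))` for real parameters and
real argument, with the convention `1/Γ(w) = 0` at poles of `Γ`. -/
noncomputable def wright (l μ x : ℝ) : ℝ :=
  ∑' n : ℕ, x ^ n / ((n.factorial : ℝ) * Real.Gamma (l * n + μ))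

/-- The Mainardi function `M_ν(x) := W_{-ν,1-ν}(-x)`. -/
noncomputable def mainardiM (ν x : ℝ) : ℝ := wright (-ν) (1 - ν) (-x)

/-- The Mittag-Leffler function `E_{α,β}(x) = ∑ xⁿ/Γ(αn+β)`. -/
noncomputable def mittagLeffler (α β x : ℝ) : ℝ :=
  ∑' n : ℕ, x ^ n / Real.Gamma (α * n + β)

open MeasureTheory Set Filter Topology Complex

theorem integrableOn_exp_neg_mul_rpow_mul_exp_rpow {f : ℝ → ℝ} {κ R b x ν : ℝ} (hκ : 0 < κ)
    (hν1 : ν < 1) (hf : ContinuousOn f (Ici 0)) (hpos : ∀ r ∈ Ici (0 : ℝ), 0 < f r)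
    (hle : ∀ r ∈ Ici (0 : ℝ), f r ≤ R + r) (htop : Tendsto f atTop atTop) :
    IntegrableOn (fun r => Real.exp (-κ * r) * f r ^ b * Real.exp (x * f r ^ ν)) (Ioi 0) := by
  have hlo : (fun y : ℝ => b * Real.log y + x * y ^ ν) =o[atTop] (fun y : ℝ => y) := by
    refine (Real.isLittleO_log_id_atTop.const_mul_left b).add
      (Asymptotics.IsLittleO.const_mul_left ?_ x)
    refine Asymptotics.isLittleO_of_tendsto' ?_ ?_
    · filter_upwards [eventually_gt_atTop 0] with y hy h
      exact absurd h hy.ne'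
    · have := tendsto_rpow_neg_atTop (y := 1 - ν) (by linarith)
      refine this.congr' ?_
      filter_upwards [eventually_gt_atTop 0] with y hy
      rw [neg_sub, Real.rpow_sub_one hy.ne', id]
  have hlo' := htop.eventually (hlo.bound (half_pos hκ))
  refine integrable_of_isBigO_exp_neg (b := κ / 2) (half_pos hκ) ?_ ?_
  · refine ContinuousOn.mul (ContinuousOn.mul (by fun_prop) ?_) ?_
    · exact hf.rpow_const fun r hr => Or.inl (hpos r hr).ne'
    · refine Real.continuous_exp.comp_continuousOn (continuousOn_const.mul ?_)
      exact hf.rpow_const fun r hr => Or.inl (hpos r hr).ne'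
  · refine Asymptotics.IsBigO.of_bound (Real.exp (κ / 2 * R)) ?_
    filter_upwards [hlo', eventually_ge_atTop 0] with r h hr
    have hp := hpos r hr
    rw [Real.norm_of_nonneg (by positivity), Real.norm_of_nonneg (by positivity),
      Real.rpow_def_of_pos hp b, ← Real.exp_add, ← Real.exp_add, ← Real.exp_add, Real.exp_le_exp]
    rw [Real.norm_of_nonneg hp.le] at h
    have h1 := (le_abs_self _).trans h
    have h2 := mul_le_mul_of_nonneg_left (hle r hr) (half_pos hκ).le
    linarith

theorem integrableOn_exp_neg_mul_add_rpow {κ R : ℝ} (hκ : 0 < κ) (hR : 0 < R) (b : ℝ) :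
    IntegrableOn (fun r => Real.exp (-κ * r) * (R + r) ^ b) (Ioi 0) := by
  have := integrableOn_exp_neg_mul_rpow_mul_exp_rpow (f := fun r => R + r) (b := b) (x := 0)
    (ν := 0) (R := R) hκ one_pos (by fun_prop) (fun r hr => by
      have : (0 : ℝ) ≤ r := hr
      positivity) (fun r _ => le_rfl) (tendsto_const_nhds.add_atTop tendsto_id)
  simpa using this

theorem integral_ofReal_rpow_mul_exp_neg_mul_exp {a β : ℝ} (ha : 1 < a) (hβ0 : 0 ≤ β)
    (hβ : β < Real.pi / 2) :
    ∫ r in Ioi (0 : ℝ), ((r ^ a : ℝ) : ℂ) * exp (-(r * exp (-(β * I)))) *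
      exp (-(β * (a + 1) * I)) =
      Real.Gamma (a + 1) := by
  set F : ℝ → ℝ → ℂ := fun y r =>
    ((r ^ a : ℝ) : ℂ) * exp (-(r * exp (-(y * I)))) * exp (-(y * (a + 1) * I)) with hF
  set F' : ℝ → ℝ → ℂ := fun y r =>
    ((r ^ a : ℝ) : ℂ) * exp (-(r * exp (-(y * I)))) * exp (-(y * (a + 1) * I)) *
      (-I * ((a + 1) - r * exp (-(y * I)))) with hF'
  have hre (y r : ℝ) : (-((r : ℂ) * exp (-(y * I)))).re = -Real.cos y * r := by
    rw [← neg_mul ((y : ℂ)), ← ofReal_neg, exp_mul_I, ← ofReal_cos, ← ofReal_sin,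
      Real.cos_neg, Real.sin_neg]
    simp only [neg_re, mul_re, add_re, add_im, mul_im, I_re, I_im, ofReal_re, ofReal_im]
    ring
  have hn1 (y : ℝ) : ‖exp (-((y : ℂ) * I))‖ = 1 := by
    rw [← neg_mul, ← ofReal_neg, norm_exp_ofReal_mul_I]
  have hn2 (y : ℝ) : ‖exp (-((y : ℂ) * (a + 1) * I))‖ = 1 := by
    have : (-((y : ℂ) * (a + 1) * I)) = ((-(y * (a + 1)) : ℝ) : ℂ) * I := by push_cast; ring
    rw [this, norm_exp_ofReal_mul_I]
  have hFn (y r : ℝ) (hr : 0 < r) : ‖F y r‖ = r ^ a * Real.exp (-Real.cos y * r) := by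
    simp only [hF, norm_mul, hn2, mul_one, norm_exp, hre, norm_real,
      Real.norm_of_nonneg (Real.rpow_nonneg hr.le a)]
  have hF'n (y r : ℝ) (hr : 0 < r) :
      ‖F' y r‖ ≤ (a + 1) * (Real.exp (-Real.cos y * r) * (1 + r) ^ (a + 1)) := by
    have e : F' y r = F y r * (-I * ((a + 1) - r * exp (-(y * I)))) := rfl
    have h1 : ‖(-I * (((a : ℂ) + 1) - r * exp (-(y * I))))‖ ≤ (a + 1) * (1 + r) := by
      rw [norm_mul, norm_neg, norm_I, one_mul]
      refine (norm_sub_le _ _).trans ?_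
      rw [norm_mul, hn1, norm_real, Real.norm_of_nonneg hr.le]
      have : ‖(a : ℂ) + 1‖ = a + 1 := by
        rw [← ofReal_one, ← ofReal_add, norm_real, Real.norm_of_nonneg (by linarith)]
      rw [this]; nlinarith
    have h2 : r ^ a ≤ (1 + r) ^ a := Real.rpow_le_rpow hr.le (by linarith) (by linarith)
    rw [e, norm_mul, hFn y r hr, Real.rpow_add_one (by positivity)]
    calc _ ≤ (1 + r) ^ a * Real.exp (-Real.cos y * r) * ((a + 1) * (1 + r)) := by gcongr
      _ = _ := by ring
  have hFc (y : ℝ) : ContinuousOn (F y) (Ioi 0) := by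
    refine ContinuousOn.mul (ContinuousOn.mul ?_ (by fun_prop)) (by fun_prop)
    exact continuous_ofReal.comp_continuousOn
      (continuousOn_id.rpow_const fun r hr => Or.inl (ne_of_gt hr))
  have hFi (y : ℝ) (hy : 0 < Real.cos y) : IntegrableOn (F y) (Ioi 0) := by
    refine Integrable.mono' (integrableOn_exp_neg_mul_add_rpow hy one_pos a)
      ((hFc y).aestronglyMeasurable measurableSet_Ioi) ?_
    refine (ae_restrict_iff' measurableSet_Ioi).2 (ae_of_all _ fun r hr => ?_)
    have hr' : 0 < r := hr
    rw [hFn y r hr, mul_comm]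
    gcongr
    linarith
  have hF'm (y : ℝ) : ContinuousOn (F' y) (Ioi 0) := (hFc y).mul (by fun_prop)
  have hderiv (y r : ℝ) : HasDerivAt (fun y => F y r) (F' y r) y := by
    have h0 : HasDerivAt (fun y : ℝ => (y : ℂ)) 1 y := ofRealCLM.hasDerivAt
    have h1 := ((h0.mul_const I).neg.cexp.const_mul (r : ℂ)).neg.cexp.const_mul ((r ^ a : ℝ) : ℂ)
    have h2 := ((h0.mul_const ((a : ℂ) + 1)).mul_const I).neg.cexp
    refine (h1.mul h2).congr_deriv ?_
    simp only [hF', Pi.neg_apply]; ring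
  have hJ (y : ℝ) (hy : 0 < Real.cos y) : HasDerivAt (fun y => ∫ r in Ioi (0 : ℝ), F y r) 0 y := by
    have hs : {z : ℝ | Real.cos y / 2 < Real.cos z} ∈ 𝓝 y :=
      (isOpen_lt continuous_const Real.continuous_cos).mem_nhds (half_lt_self hy)
    have key := hasDerivAt_integral_of_dominated_loc_of_deriv_le (μ := volume.restrict (Ioi (0 : ℝ)))
      (F := F) (F' := F') (x₀ := y)
      (bound := fun r => (a + 1) * (Real.exp (-(Real.cos y / 2) * r) * (1 + r) ^ (a + 1))) hs
      (Eventually.of_forall fun z => (hFc z).aestronglyMeasurable measurableSet_Ioi) (hFi y hy)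
      ((hF'm y).aestronglyMeasurable measurableSet_Ioi) ?_
      ((integrableOn_exp_neg_mul_add_rpow (half_pos hy) one_pos (a + 1)).const_mul _)
      (ae_of_all _ fun r z _ => hderiv z r)
    · refine key.2.congr_deriv ?_
      set G : ℝ → ℂ := fun r => -I * (r * F y r) with hG
      have hGd : ∀ r ∈ Ioi (0 : ℝ), HasDerivAt G (F' y r) r := by
        intro r hr
        have hr' : (r : ℝ) ≠ 0 := ne_of_gt hr
        have h0 : HasDerivAt (fun y : ℝ => (y : ℂ)) 1 r := ofRealCLM.hasDerivAt
        have h1 := (Real.hasDerivAt_rpow_const (x := r) (p := a) (Or.inl hr')).ofReal_comp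
        have h2 := (h0.mul_const (exp (-((y : ℂ) * I)))).neg.cexp
        have h3 := (h0.mul ((h1.mul h2).mul_const (exp (-(y * (a + 1) * I))))).const_mul (-I)
        refine h3.congr_deriv ?_
        have : r ^ a = r ^ (a - 1) * r := by
          rw [← Real.rpow_add_one hr', sub_add_cancel]
        simp only [hF', Pi.neg_apply, Pi.mul_apply, this]
        push_cast
        ring
      have hGi : IntegrableOn G (Ioi 0) := by
        refine Integrable.mono' (integrableOn_exp_neg_mul_add_rpow hy one_pos (a + 1))
          (ContinuousOn.aestronglyMeasurable (continuousOn_const.mul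
            (continuous_ofReal.continuousOn.mul (hFc y))) measurableSet_Ioi) ?_
        refine (ae_restrict_iff' measurableSet_Ioi).2 (ae_of_all _ fun r hr => ?_)
        have hr' : 0 < r := hr
        simp only [hG, norm_mul, norm_neg, norm_I, one_mul, norm_real, Real.norm_of_nonneg hr'.le,
          hFn y r hr]
        rw [Real.rpow_add_one (by positivity)]
        have h2 : r ^ a ≤ (1 + r) ^ a := Real.rpow_le_rpow hr'.le (by linarith) (by linarith)
        calc _ ≤ (1 + r) * ((1 + r) ^ a * Real.exp (-Real.cos y * r)) := by gcongr; linarith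
          _ = _ := by ring
      have h0 : ContinuousWithinAt G (Ici 0) 0 := by
        refine Continuous.continuousWithinAt ?_
        have : Continuous fun r : ℝ => r ^ a := Real.continuous_rpow_const (by linarith)
        fun_prop
      rw [integral_Ioi_of_hasDerivAt_of_tendsto h0 hGd key.1
        (tendsto_zero_of_hasDerivAt_of_integrableOn_Ioi hGd key.1 hGi)]
      simp [hG]
    · refine (ae_restrict_iff' measurableSet_Ioi).2 (ae_of_all _ fun r hr z hz => ?_)
      have hr' : 0 < r := hr
      have hz' : Real.cos y / 2 < Real.cos z := hz
      refine (hF'n z r hr).trans ?_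
      gcongr
  have hcos (y : ℝ) (h0 : 0 ≤ y) (h1 : y ≤ β) : 0 < Real.cos y :=
    Real.cos_pos_of_mem_Ioo ⟨by linarith [Real.pi_pos], by linarith⟩
  have hconst := constant_of_has_deriv_right_zero (f := fun y => ∫ r in Ioi (0 : ℝ), F y r)
    (a := 0) (b := β) (fun y hy => (hJ y (hcos y hy.1 hy.2)).continuousAt.continuousWithinAt)
    (fun y hy => (hJ y (hcos y hy.1 hy.2.le)).hasDerivWithinAt) β ⟨hβ0, le_rfl⟩
  refine hconst.trans ?_
  rw [Real.Gamma_eq_integral (by linarith), ← integral_complex_ofReal]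
  refine setIntegral_congr_fun measurableSet_Ioi fun r hr => ?_
  simp [hF, mul_comm]

/-- The ray from `c` in the direction `exp (θ * I)`; together with its complex conjugate it forms
a Hankel contour. -/
noncomputable def hankelRay (θ c r : ℝ) : ℂ := c + r * exp (θ * I)

/-- The integral of `t ↦ exp t * t ^ a` along `hankelRay θ c`. -/
noncomputable def hankelIntegral (θ c a : ℝ) : ℂ :=
  ∫ r in Ioi (0 : ℝ), exp (hankelRay θ c r) * hankelRay θ c r ^ (a : ℂ) * exp (θ * I)

theorem hankelRay_re (θ c r : ℝ) : (hankelRay θ c r).re = c + r * Real.cos θ := by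
  simp [hankelRay, exp_ofReal_mul_I_re]

theorem hankelRay_im (θ c r : ℝ) : (hankelRay θ c r).im = r * Real.sin θ := by
  simp [hankelRay, exp_ofReal_mul_I_im]

theorem continuous_hankelRay (θ c : ℝ) : Continuous (hankelRay θ c) := by
  unfold hankelRay; fun_prop

theorem norm_hankelRay_le {θ c r : ℝ} (hr : 0 ≤ r) : ‖hankelRay θ c r‖ ≤ |c| + r := by
  refine (norm_add_le _ _).trans ?_
  rw [norm_mul, norm_exp_ofReal_mul_I, norm_real, norm_real, Real.norm_eq_abs,
    Real.norm_of_nonneg hr, mul_one]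

theorem mul_sin_le_norm_hankelRay (θ c r : ℝ) : c * Real.sin θ ≤ ‖hankelRay θ c r‖ := by
  refine le_of_sq_le_sq ?_ (norm_nonneg _)
  rw [← normSq_eq_norm_sq, normSq_apply, hankelRay_re, hankelRay_im]
  rw [← sub_nonneg]
  refine (sq_nonneg (r + c * Real.cos θ)).trans_eq ?_
  linear_combination (c ^ 2 - r ^ 2) * Real.sin_sq_add_cos_sq θ

theorem hankelRay_mem_slitPlane {θ c r : ℝ} (hθ : 0 < Real.sin θ) (hr : 0 < r) :
    hankelRay θ c r ∈ slitPlane :=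
  Or.inr (by rw [hankelRay_im]; positivity)

theorem hankelRay_mem_slitPlane_of_pos {θ c r : ℝ} (hθ : 0 < Real.sin θ) (hc : 0 < c)
    (hr : 0 ≤ r) : hankelRay θ c r ∈ slitPlane := by
  rcases hr.eq_or_lt with rfl | hr
  · exact Or.inl (by simpa [hankelRay_re])
  · exact hankelRay_mem_slitPlane hθ hr

theorem norm_hankelRay_pos {θ c r : ℝ} (hθ : 0 < Real.sin θ) (hc : 0 < c) :
    0 < ‖hankelRay θ c r‖ :=
  (mul_pos hc hθ).trans_le (mul_sin_le_norm_hankelRay θ c r)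

theorem tendsto_norm_hankelRay {θ : ℝ} (hθ : 0 < Real.sin θ) (c : ℝ) :
    Tendsto (fun r => ‖hankelRay θ c r‖) atTop atTop := by
  refine tendsto_atTop_mono (fun r => ?_) (tendsto_id.atTop_mul_const hθ)
  rw [id, ← hankelRay_im θ c r]
  exact (le_abs_self _).trans (abs_im_le_norm _)

theorem norm_exp_mul_hankelRay_cpow (θ c a r : ℝ) :
    ‖exp (hankelRay θ c r) * hankelRay θ c r ^ (a : ℂ) * exp (θ * I)‖ =
      Real.exp (c + r * Real.cos θ) * ‖hankelRay θ c r‖ ^ a := by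
  rw [norm_mul, norm_mul, norm_exp_ofReal_mul_I, mul_one, norm_exp, hankelRay_re, norm_cpow_real]

theorem integrableOn_hankelRay_rpow_mul_exp {θ c b x ν : ℝ} (hθ : 0 < Real.sin θ)
    (hθ' : Real.cos θ < 0) (hc : 0 < c) (hν1 : ν < 1) :
    IntegrableOn (fun r => Real.exp (c + r * Real.cos θ) * ‖hankelRay θ c r‖ ^ b *
      Real.exp (x * ‖hankelRay θ c r‖ ^ ν)) (Ioi 0) := by
  have := (integrableOn_exp_neg_mul_rpow_mul_exp_rpow (f := fun r => ‖hankelRay θ c r‖)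
    (R := |c|) (b := b) (x := x) (neg_pos.2 hθ') hν1 (continuous_hankelRay θ c).norm.continuousOn
    (fun r _ => norm_hankelRay_pos hθ hc) (fun r hr => norm_hankelRay_le hr)
    (tendsto_norm_hankelRay hθ c)).const_mul (Real.exp c)
  refine this.congr (ae_of_all _ fun r => ?_)
  simp only [Real.exp_add, neg_neg, mul_comm (Real.cos θ) r]
  ring

theorem integrableOn_hankelRay_rpow {θ c : ℝ} (hθ : 0 < Real.sin θ)
    (hθ' : Real.cos θ < 0) (hc : 0 < c) (b : ℝ) :
    IntegrableOn (fun r => Real.exp (c + r * Real.cos θ) * ‖hankelRay θ c r‖ ^ b) (Ioi 0) := by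
  simpa using integrableOn_hankelRay_rpow_mul_exp (b := b) (x := 0) (ν := 0) hθ hθ' hc one_pos

theorem continuousOn_hankelRay_cpow {θ : ℝ} (hθ : 0 < Real.sin θ) (c a : ℝ) :
    ContinuousOn (fun r => exp (hankelRay θ c r) * hankelRay θ c r ^ (a : ℂ) * exp (θ * I))
      (Ioi 0) := by
  have h := continuous_hankelRay θ c
  refine ((by fun_prop : Continuous fun r => exp (hankelRay θ c r)).continuousOn.mul ?_).mul
    continuousOn_const
  exact h.continuousOn.cpow_const fun r hr => hankelRay_mem_slitPlane hθ hr

theorem integrableOn_hankelRay_cpow {θ c : ℝ} (hθ : 0 < Real.sin θ)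
    (hθ' : Real.cos θ < 0) (hc : 0 < c) (a : ℝ) :
    IntegrableOn (fun r => exp (hankelRay θ c r) * hankelRay θ c r ^ (a : ℂ) * exp (θ * I))
      (Ioi 0) :=
  (integrableOn_hankelRay_rpow hθ hθ' hc a).mono'
    ((continuousOn_hankelRay_cpow hθ c a).aestronglyMeasurable measurableSet_Ioi)
    (ae_of_all _ fun r => (norm_exp_mul_hankelRay_cpow θ c a r).le)

theorem norm_exp_mul_hankelRay_cpow_le {θ c C a r : ℝ} (ha : 0 ≤ a) (hc : |c| ≤ C) (hr : 0 < r) :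
    ‖exp (hankelRay θ c r) * hankelRay θ c r ^ (a : ℂ) * exp (θ * I)‖ ≤
      Real.exp C * (Real.exp (-(-Real.cos θ) * r) * (C + r) ^ a) := by
  rw [norm_exp_mul_hankelRay_cpow, ← mul_assoc, ← Real.exp_add]
  have h1 : ‖hankelRay θ c r‖ ≤ C + r := (norm_hankelRay_le hr.le).trans (by linarith)
  have h2 := (le_abs_self c).trans hc
  gcongr Real.exp ?_ * ?_ ^ a
  linarith

theorem integrableOn_hankelRay_cpow_of_nonneg {θ a : ℝ} (hθ : 0 < Real.sin θ)
    (hθ' : Real.cos θ < 0) (c : ℝ) (ha : 0 ≤ a) :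
    IntegrableOn (fun r => exp (hankelRay θ c r) * hankelRay θ c r ^ (a : ℂ) * exp (θ * I))
      (Ioi 0) := by
  refine ((integrableOn_exp_neg_mul_add_rpow (neg_pos.2 hθ') (R := |c| + 1) (by positivity)
    a).const_mul (Real.exp (|c| + 1))).mono'
    ((continuousOn_hankelRay_cpow hθ c a).aestronglyMeasurable measurableSet_Ioi) ?_
  exact (ae_restrict_iff' measurableSet_Ioi).2 (ae_of_all _ fun r hr =>
    norm_exp_mul_hankelRay_cpow_le ha (by linarith) hr)

theorem hasDerivAt_exp_mul_cpow {z : ℂ} (hz : z ∈ slitPlane) (a : ℝ) :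
    HasDerivAt (fun z => exp z * z ^ (a : ℂ))
      (exp z * z ^ (a : ℂ) + a * (exp z * z ^ ((a - 1 : ℝ) : ℂ))) z := by
  refine ((hasDerivAt_exp z).mul ((hasDerivAt_id z).cpow_const hz)).congr_deriv ?_
  push_cast; simp only [id]; ring

theorem im_hankelIntegral_add {θ c a : ℝ} (hθ : 0 < Real.sin θ) (hc : 0 ≤ c) (hca : 0 < c ∨ 0 < a)
    (h0 : IntegrableOn (fun r => exp (hankelRay θ c r) * hankelRay θ c r ^ (a : ℂ) * exp (θ * I))
      (Ioi 0))
    (h1 : IntegrableOn (fun r => exp (hankelRay θ c r) * hankelRay θ c r ^ ((a - 1 : ℝ) : ℂ) *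
      exp (θ * I)) (Ioi 0)) :
    (hankelIntegral θ c a).im + a * (hankelIntegral θ c (a - 1)).im = 0 := by
  set G : ℝ → ℂ := fun r => exp (hankelRay θ c r) * hankelRay θ c r ^ (a : ℂ) with hG
  have hGd : ∀ r ∈ Ioi (0 : ℝ), HasDerivAt G
      (exp (hankelRay θ c r) * hankelRay θ c r ^ (a : ℂ) * exp (θ * I) +
        a * (exp (hankelRay θ c r) * hankelRay θ c r ^ ((a - 1 : ℝ) : ℂ) * exp (θ * I))) r := by
    intro r hr
    have e : HasDerivAt (hankelRay θ c) (exp (θ * I)) r := by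
      have h0 : HasDerivAt (fun y : ℝ => (y : ℂ)) 1 r := ofRealCLM.hasDerivAt
      exact ((h0.mul_const (exp (θ * I))).const_add (c : ℂ)).congr_deriv (one_mul _)
    refine ((hasDerivAt_exp_mul_cpow (hankelRay_mem_slitPlane hθ hr) a).comp r e).congr_deriv ?_
    ring
  have hGi : IntegrableOn G (Ioi 0) := by
    refine (h0.mul_const (exp (θ * I))⁻¹).congr (ae_of_all _ fun r => ?_)
    simp only [hG, mul_assoc, mul_inv_cancel₀ (exp_ne_zero _), mul_one]
  have hG'i := h0.add (h1.const_mul (a : ℂ))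
  have hG0 : ContinuousWithinAt G (Ici 0) 0 := by
    refine ContinuousAt.continuousWithinAt ?_
    have h := (continuous_hankelRay θ c).continuousAt (x := 0)
    refine h.cexp.mul ?_
    have e0 : hankelRay θ c 0 = c := by simp [hankelRay]
    rcases hca with hc' | ha
    · exact h.cpow continuousAt_const (hankelRay_mem_slitPlane_of_pos hθ hc' le_rfl)
    · refine ContinuousAt.comp (g := fun z : ℂ => z ^ (a : ℂ)) ?_ h
      exact continuousAt_cpow_const_of_re_pos (Or.inl (by rw [e0]; exact_mod_cast hc))
        (by exact_mod_cast ha)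
  have key := integral_Ioi_of_hasDerivAt_of_tendsto hG0 hGd hG'i
    (tendsto_zero_of_hasDerivAt_of_integrableOn_Ioi hGd hG'i hGi)
  rw [integral_add h0 (h1.const_mul (a : ℂ)), integral_const_mul] at key
  have e : G 0 = ((Real.exp c * c ^ a : ℝ) : ℂ) := by
    simp [hG, hankelRay, ofReal_cpow hc]
  rw [e] at key
  have := congrArg Complex.im key
  rw [add_im, im_ofReal_mul, zero_sub, neg_im, ofReal_im, neg_zero] at this
  exact this

theorem im_hankelIntegral_eq_of_one_lt {θ c a : ℝ} (hθ : 0 < Real.sin θ) (hθ' : Real.cos θ < 0)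
    (ha : 1 < a) (hc : 0 ≤ c) : (hankelIntegral θ c a).im = (hankelIntegral θ 0 a).im := by
  have hder (y : ℝ) (hy : 0 ≤ y) :
      HasDerivAt (fun y => (hankelIntegral θ y a).im) 0 y := by
    have i0 := integrableOn_hankelRay_cpow_of_nonneg hθ hθ' y (a := a) (by linarith)
    have i1 := integrableOn_hankelRay_cpow_of_nonneg hθ hθ' y (a := a - 1) (by linarith)
    have key := hasDerivAt_integral_of_dominated_loc_of_deriv_le
      (μ := volume.restrict (Ioi (0 : ℝ)))
      (F := fun y r => exp (hankelRay θ y r) * hankelRay θ y r ^ (a : ℂ) * exp (θ * I))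
      (F' := fun y r => exp (hankelRay θ y r) * hankelRay θ y r ^ (a : ℂ) * exp (θ * I) +
        a * (exp (hankelRay θ y r) * hankelRay θ y r ^ ((a - 1 : ℝ) : ℂ) * exp (θ * I)))
      (x₀ := y)
      (bound := fun r =>
        Real.exp (|y| + 1) * (Real.exp (-(-Real.cos θ) * r) * (|y| + 1 + r) ^ a) +
        a * (Real.exp (|y| + 1) * (Real.exp (-(-Real.cos θ) * r) * (|y| + 1 + r) ^ (a - 1))))
      (Metric.ball_mem_nhds y one_pos)
      (Eventually.of_forall fun z =>
        (continuousOn_hankelRay_cpow hθ z a).aestronglyMeasurable measurableSet_Ioi) i0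
      (i0.add (i1.const_mul (a : ℂ))).aestronglyMeasurable ?_ ?_ ?_
    · have h := imCLM.hasFDerivAt.comp_hasDerivAt y key.2
      refine h.congr_deriv ?_
      rw [integral_add i0 (i1.const_mul (a : ℂ)), integral_const_mul, imCLM_apply, add_im,
        im_ofReal_mul]
      exact im_hankelIntegral_add hθ hy (Or.inr (by linarith)) i0 i1
    · refine (ae_restrict_iff' measurableSet_Ioi).2 (ae_of_all _ fun r hr z hz => ?_)
      have hz' : |z| ≤ |y| + 1 := by
        have h1 : |z - y| < 1 := by simpa [Real.dist_eq] using hz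
        have := abs_sub_abs_le_abs_sub z y
        linarith
      refine norm_add_le_of_le
        (norm_exp_mul_hankelRay_cpow_le (by linarith) hz' hr) ?_
      rw [norm_mul, norm_real, Real.norm_of_nonneg (by linarith)]
      exact mul_le_mul_of_nonneg_left
        (norm_exp_mul_hankelRay_cpow_le (by linarith) hz' hr) (by linarith)
    · have hR : 0 < |y| + 1 := by positivity
      exact ((integrableOn_exp_neg_mul_add_rpow (neg_pos.2 hθ') hR a).const_mul _).add
        (((integrableOn_exp_neg_mul_add_rpow (neg_pos.2 hθ') hR (a - 1)).const_mul _).const_mul _)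
    · refine (ae_restrict_iff' measurableSet_Ioi).2 (ae_of_all _ fun r hr z _ => ?_)
      have e : HasDerivAt (fun z => hankelRay θ z r) 1 z :=
        HasDerivAt.add_const _ ofRealCLM.hasDerivAt
      refine (((hasDerivAt_exp_mul_cpow (hankelRay_mem_slitPlane hθ hr) a).comp z
        e).mul_const (exp (θ * I))).congr_deriv ?_
      ring
  exact constant_of_has_deriv_right_zero (f := fun y => (hankelIntegral θ y a).im) (a := 0) (b := c)
    (fun y hy => (hder y hy.1).continuousAt.continuousWithinAt)
    (fun y hy => (hder y hy.1).hasDerivWithinAt) c ⟨hc, le_rfl⟩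

theorem hankelIntegral_zero {θ a : ℝ} (ha : 1 < a) (hθ : Real.pi / 2 < θ) (hθ' : θ ≤ Real.pi) :
    hankelIntegral θ 0 a = Real.Gamma (a + 1) * exp ((Real.pi * (a + 1) : ℝ) * I) := by
  rw [← integral_ofReal_rpow_mul_exp_neg_mul_exp ha (β := Real.pi - θ) (by linarith) (by linarith),
    ← integral_mul_const]
  refine setIntegral_congr_fun measurableSet_Ioi fun r hr => ?_
  have hr' : 0 < r := hr
  have e1 : exp (-((Real.pi - θ : ℝ) * I)) = -exp (θ * I) := by
    have : (-((Real.pi - θ : ℝ) * I)) = θ * I - Real.pi * I := by push_cast; ring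
    rw [this, exp_sub, exp_pi_mul_I, div_neg, div_one]
  have e2 : hankelRay θ 0 r ^ (a : ℂ) = ((r ^ a : ℝ) : ℂ) * exp (a * (θ * I)) := by
    rw [hankelRay, ofReal_zero, zero_add, cpow_def_of_ne_zero (by simp [hr'.ne']),
      log_ofReal_mul hr' (exp_ne_zero _), log_exp (by simp; linarith [Real.pi_pos])
      (by simpa using hθ'), Real.rpow_def_of_pos hr', ofReal_exp, ← exp_add]
    push_cast; ring_nf
  have e3 : exp (a * (θ * I)) * exp (θ * I) = exp (-((Real.pi - θ : ℝ) * (a + 1) * I)) *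
      exp ((Real.pi * (a + 1) : ℝ) * I) := by
    rw [← exp_add, ← exp_add]
    push_cast; ring_nf
  simp only [e2, e1]
  rw [mul_assoc (_ * _) (exp (-_)), ← e3, hankelRay, ofReal_zero, zero_add, mul_neg, neg_neg]
  ring

theorem Real.continuous_inv_Gamma : Continuous fun x : ℝ => (Real.Gamma x)⁻¹ := by
  have h : Continuous fun x : ℝ => ((Complex.Gamma (x : ℂ))⁻¹).re :=
    continuous_re.comp (differentiable_one_div_Gamma.continuous.comp continuous_ofReal)
  refine h.congr fun x => ?_
  rw [Complex.Gamma_ofReal, ← ofReal_inv, ofReal_re]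

theorem Real.rpow_le_rpow_add_rpow {x y z w : ℝ} (hx : 0 < x) (hy : y ≤ z) (hw : z ≤ w) :
    x ^ z ≤ x ^ w + x ^ y := by
  rcases le_total 1 x with h | h
  · exact (Real.rpow_le_rpow_of_exponent_le h hw).trans
      (le_add_of_nonneg_right (Real.rpow_nonneg hx.le y))
  · exact (Real.rpow_le_rpow_of_exponent_ge hx h hy).trans
      (le_add_of_nonneg_left (Real.rpow_nonneg hx.le w))

theorem continuous_hankelIntegral {θ c : ℝ} (hθ : 0 < Real.sin θ) (hθ' : Real.cos θ < 0)
    (hc : 0 < c) : Continuous (hankelIntegral θ c) := by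
  refine continuous_iff_continuousAt.2 fun a => ?_
  refine continuousAt_of_dominated (bound := fun r =>
      Real.exp (c + r * Real.cos θ) * ‖hankelRay θ c r‖ ^ (a + 1) +
      Real.exp (c + r * Real.cos θ) * ‖hankelRay θ c r‖ ^ (a - 1))
    (Eventually.of_forall fun b =>
      (continuousOn_hankelRay_cpow hθ c b).aestronglyMeasurable measurableSet_Ioi) ?_
    ((integrableOn_hankelRay_rpow hθ hθ' hc _).add (integrableOn_hankelRay_rpow hθ hθ' hc _)) ?_
  · filter_upwards [Ioo_mem_nhds (sub_one_lt a) (lt_add_one a)] with b hb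
    refine ae_of_all _ fun r => ?_
    rw [norm_exp_mul_hankelRay_cpow, ← mul_add]
    gcongr
    exact Real.rpow_le_rpow_add_rpow (norm_hankelRay_pos hθ hc) hb.1.le hb.2.le
  · refine ae_of_all _ fun r => Continuous.continuousAt ?_
    have h0 : hankelRay θ c r ≠ 0 := norm_pos_iff.1 (norm_hankelRay_pos hθ hc)
    have : Continuous fun b : ℝ => hankelRay θ c r ^ (b : ℂ) :=
      continuous_ofReal.const_cpow (Or.inl h0)
    fun_prop

/-- Hankel's integral representation of the reciprocal Gamma function. -/
theorem im_hankelIntegral {θ c : ℝ} (hθ : Real.pi / 2 < θ) (hθ' : θ < Real.pi) (hc : 0 < c)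
    (a : ℝ) : (hankelIntegral θ c a).im = Real.pi * (Real.Gamma (-a))⁻¹ := by
  have hs : 0 < Real.sin θ := Real.sin_pos_of_pos_of_lt_pi (by linarith [Real.pi_pos]) hθ'
  have hcos : Real.cos θ < 0 := Real.cos_neg_of_pi_div_two_lt_of_lt hθ (by linarith [Real.pi_pos])
  have hlarge (a : ℝ) (ha : 1 < a) (haZ : a ∉ range ((↑) : ℤ → ℝ)) :
      (hankelIntegral θ c a).im = Real.pi * (Real.Gamma (-a))⁻¹ := by
    rw [im_hankelIntegral_eq_of_one_lt hs hcos ha hc.le, hankelIntegral_zero ha hθ hθ'.le,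
      im_ofReal_mul, exp_ofReal_mul_I_im]
    have h1 := Real.Gamma_mul_Gamma_one_sub (a + 1)
    rw [show 1 - (a + 1) = -a by ring] at h1
    have hsin : Real.sin (Real.pi * (a + 1)) ≠ 0 := by
      intro h
      obtain ⟨n, hn⟩ := Real.sin_eq_zero_iff.1 h
      refine haZ ⟨n - 1, ?_⟩
      have := mul_right_cancel₀ Real.pi_ne_zero (hn.trans (mul_comm _ _))
      push_cast; linarith
    have hG : Real.Gamma (-a) ≠ 0 := by
      intro h
      rw [h, mul_zero] at h1
      exact div_ne_zero Real.pi_ne_zero hsin h1.symm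
    rw [eq_div_iff hsin] at h1
    rw [eq_mul_inv_iff_mul_eq₀ hG]
    linear_combination h1
  have hind (n : ℕ) : ∀ a : ℝ, 1 - n < a → a ∉ range ((↑) : ℤ → ℝ) →
      (hankelIntegral θ c a).im = Real.pi * (Real.Gamma (-a))⁻¹ := by
    induction n with
    | zero => intro a ha; exact hlarge a (by simpa using ha)
    | succ n ih =>
      intro a ha haZ
      have haZ' : a + 1 ∉ range ((↑) : ℤ → ℝ) := by
        rintro ⟨m, hm⟩
        exact haZ ⟨m - 1, by push_cast; linarith⟩
      have h1 := ih (a + 1) (by push_cast at ha; linarith) haZ'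
      have h2 := im_hankelIntegral_add hs hc.le (Or.inl hc)
        (integrableOn_hankelRay_cpow hs hcos hc (a + 1))
        (integrableOn_hankelRay_cpow hs hcos hc (a + 1 - 1))
      rw [h1, add_sub_cancel_right] at h2
      have hne : a + 1 ≠ 0 := fun h => haZ' ⟨0, by simp [h]⟩
      have h3 := Real.Gamma_add_one (s := -(a + 1)) (neg_ne_zero.2 hne)
      rw [show -(a + 1) + 1 = -a by ring] at h3
      rw [h3, mul_inv, inv_neg]
      refine mul_left_cancel₀ hne ?_
      rw [eq_neg_of_add_eq_zero_right h2]
      field_simp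
  refine congrFun (Continuous.ext_on (Set.Countable.dense_compl ℝ (countable_range ((↑) : ℤ → ℝ)))
    (continuous_im.comp (continuous_hankelIntegral hs hcos hc))
    (continuous_const.mul (Real.continuous_inv_Gamma.comp continuous_neg)) fun b hb => ?_) a
  obtain ⟨n, hn⟩ := exists_nat_gt (1 - b)
  exact hind n b (by linarith) hb

theorem arg_hankelRay_mem_Icc {θ c r : ℝ} (hθ0 : 0 < θ) (hθ : θ < Real.pi) (hc : 0 < c)
    (hr : 0 ≤ r) : arg (hankelRay θ c r) ∈ Icc 0 θ := by
  have hs : 0 < Real.sin θ := Real.sin_pos_of_pos_of_lt_pi hθ0 hθ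
  refine ⟨arg_nonneg_iff.2 (by rw [hankelRay_im]; positivity), ?_⟩
  by_contra! h
  have h1 : 0 < Real.sin (arg (hankelRay θ c r) - θ) :=
    Real.sin_pos_of_pos_of_lt_pi (by linarith) (by linarith [arg_le_pi (hankelRay θ c r)])
  have h2 := mul_pos (norm_hankelRay_pos (r := r) hs hc) h1
  rw [Real.sin_sub, mul_sub, ← mul_assoc, ← mul_assoc, norm_mul_sin_arg, norm_mul_cos_arg,
    hankelRay_re, hankelRay_im] at h2
  nlinarith [mul_pos hc hs]

theorem le_re_hankelRay_cpow {θ c r ν : ℝ} (hθ0 : 0 < θ) (hθ : θ < Real.pi) (hc : 0 < c)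
    (hr : 0 ≤ r) (hν : 0 < ν) (hνθ : θ * ν < Real.pi / 2) :
    (c * Real.sin θ) ^ ν * Real.cos (θ * ν) ≤ (hankelRay θ c r ^ (ν : ℂ)).re := by
  have hs : 0 < Real.sin θ := Real.sin_pos_of_pos_of_lt_pi hθ0 hθ
  obtain ⟨h1, h2⟩ := arg_hankelRay_mem_Icc hθ0 hθ hc hr
  rw [cpow_ofReal_re]
  have h3 : Real.cos (θ * ν) ≤ Real.cos (arg (hankelRay θ c r) * ν) :=
    Real.cos_le_cos_of_nonneg_of_le_pi (by positivity) (by linarith [Real.pi_pos]) (by gcongr)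
  have h4 : 0 ≤ Real.cos (θ * ν) :=
    Real.cos_nonneg_of_mem_Icc ⟨by linarith [mul_pos hθ0 hν, Real.pi_pos], hνθ.le⟩
  gcongr
  exact mul_sin_le_norm_hankelRay θ c r

theorem cpow_ofReal_add_mul_natCast {z : ℂ} (hz : z ≠ 0) (b ν : ℝ) (n : ℕ) :
    z ^ ((b + ν * n : ℝ) : ℂ) = z ^ (b : ℂ) * (z ^ (ν : ℂ)) ^ n := by
  rw [ofReal_add, cpow_add _ _ hz, ofReal_mul, ofReal_natCast, cpow_mul_nat]

theorem mainardiM_eq_im_integral {θ c ν : ℝ} (hθ : Real.pi / 2 < θ) (hθ' : θ < Real.pi)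
    (hc : 0 < c) (hν1 : ν < 1) (x : ℝ) :
    mainardiM ν x = Real.pi⁻¹ * (∫ r in Ioi (0 : ℝ),
      exp (hankelRay θ c r) * hankelRay θ c r ^ ((ν - 1 : ℝ) : ℂ) * exp (θ * I) *
        exp (-x * hankelRay θ c r ^ (ν : ℂ))).im := by
  have hs : 0 < Real.sin θ := Real.sin_pos_of_pos_of_lt_pi (by linarith [Real.pi_pos]) hθ'
  have hcos : Real.cos θ < 0 := Real.cos_neg_of_pi_div_two_lt_of_lt hθ (by linarith [Real.pi_pos])
  have hp (r : ℝ) : hankelRay θ c r ≠ 0 := norm_pos_iff.1 (norm_hankelRay_pos hs hc)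
  have hexp (r : ℝ) : HasSum (fun n : ℕ => Real.exp (c + r * Real.cos θ) *
      ‖hankelRay θ c r‖ ^ (ν - 1) * ((|x| * ‖hankelRay θ c r‖ ^ ν) ^ n / n.factorial))
      (Real.exp (c + r * Real.cos θ) * ‖hankelRay θ c r‖ ^ (ν - 1) *
        Real.exp (|x| * ‖hankelRay θ c r‖ ^ ν)) := by
    have h := NormedSpace.expSeries_div_hasSum_exp (|x| * ‖hankelRay θ c r‖ ^ ν)
    rw [← Real.exp_eq_exp_ℝ] at h
    exact h.mul_left _
  have hsum := hasSum_integral_of_dominated_convergence (μ := volume.restrict (Ioi (0 : ℝ)))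
    (F := fun (n : ℕ) r => (((-x) ^ n / n.factorial : ℝ) : ℂ) * (exp (hankelRay θ c r) *
      hankelRay θ c r ^ ((ν - 1 + ν * n : ℝ) : ℂ) * exp (θ * I)))
    (f := fun r => exp (hankelRay θ c r) * hankelRay θ c r ^ ((ν - 1 : ℝ) : ℂ) * exp (θ * I) *
        exp (-x * hankelRay θ c r ^ (ν : ℂ)))
    (fun (n : ℕ) r => Real.exp (c + r * Real.cos θ) *
      ‖hankelRay θ c r‖ ^ (ν - 1) * ((|x| * ‖hankelRay θ c r‖ ^ ν) ^ n / n.factorial))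
    (fun n => ((continuousOn_hankelRay_cpow hs c _).aestronglyMeasurable
      measurableSet_Ioi).const_mul _)
    (fun n => ae_of_all _ fun r => ?_)
    (ae_of_all _ fun r => (hexp r).summable) ?_
    (ae_of_all _ fun r => ?_)
  · have him := (hasSum_im hsum).mul_left Real.pi⁻¹
    rw [← him.tsum_eq]
    refine tsum_congr fun n => ?_
    rw [integral_const_mul, im_ofReal_mul]
    change _ = Real.pi⁻¹ * (_ * (hankelIntegral θ c (ν - 1 + ν * n)).im)
    rw [im_hankelIntegral hθ hθ' hc, show -(ν - 1 + ν * n) = -ν * n + (1 - ν) by ring]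
    have := Real.pi_ne_zero
    rw [mul_left_comm, inv_mul_cancel_left₀ this, ← div_div, div_eq_mul_inv _ (Real.Gamma _)]
  · rw [norm_mul, norm_exp_mul_hankelRay_cpow, ← norm_cpow_real (hankelRay θ c r),
      cpow_ofReal_add_mul_natCast (hp r), norm_mul, norm_pow, norm_cpow_real, norm_cpow_real,
      norm_real, norm_div, norm_pow, norm_neg, Real.norm_eq_abs, Real.norm_natCast, mul_pow]
    exact (by ring : _ = _).le
  · simp only [fun r => (hexp r).tsum_eq]
    exact integrableOn_hankelRay_rpow_mul_exp hs hcos hc hν1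
  · have h := (NormedSpace.expSeries_div_hasSum_exp (-x * hankelRay θ c r ^ (ν : ℂ))).mul_left
      (exp (hankelRay θ c r) * hankelRay θ c r ^ ((ν - 1 : ℝ) : ℂ) * exp (θ * I))
    rw [← exp_eq_exp_ℂ] at h
    refine Eq.subst (motive := fun F : ℕ → ℂ => HasSum F _) (funext fun n => ?_) h
    rw [cpow_ofReal_add_mul_natCast (hp r), mul_pow]
    push_cast
    ring

theorem mittagLeffler_neg_eq_im_integral {θ c ν s : ℝ} (hθ : Real.pi / 2 < θ) (hθ' : θ < Real.pi)
    (hc : 0 < c) (hν : 0 < ν) (hsc : |s| < (c * Real.sin θ) ^ ν) :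
    mittagLeffler ν 1 (-s) = Real.pi⁻¹ * (∫ r in Ioi (0 : ℝ),
      exp (hankelRay θ c r) * hankelRay θ c r ^ ((ν - 1 : ℝ) : ℂ) * exp (θ * I) *
        (s + hankelRay θ c r ^ (ν : ℂ))⁻¹).im := by
  have hs : 0 < Real.sin θ := Real.sin_pos_of_pos_of_lt_pi (by linarith [Real.pi_pos]) hθ'
  have hcos : Real.cos θ < 0 := Real.cos_neg_of_pi_div_two_lt_of_lt hθ (by linarith [Real.pi_pos])
  have hp (r : ℝ) : hankelRay θ c r ≠ 0 := norm_pos_iff.1 (norm_hankelRay_pos hs hc)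
  have hd : 0 < (c * Real.sin θ) ^ ν := (abs_nonneg s).trans_lt hsc
  set q : ℝ := |s| / (c * Real.sin θ) ^ ν with hq
  have hq0 : 0 ≤ q := by positivity
  have hq1 : q < 1 := (div_lt_one hd).2 hsc
  have hle (r : ℝ) : (c * Real.sin θ) ^ ν ≤ ‖hankelRay θ c r‖ ^ ν :=
    Real.rpow_le_rpow (by positivity) (mul_sin_le_norm_hankelRay θ c r) hν.le
  have hratio (r : ℝ) : ‖-(s : ℂ) * hankelRay θ c r ^ ((-ν : ℝ) : ℂ)‖ ≤ q := by
    rw [norm_mul, norm_neg, norm_real, Real.norm_eq_abs, norm_cpow_real,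
      Real.rpow_neg (norm_nonneg _), ← div_eq_mul_inv, hq]
    exact div_le_div_of_nonneg_left (abs_nonneg s) hd (hle r)
  have hterm (n : ℕ) (r : ℝ) : (((-s) ^ n : ℝ) : ℂ) * (exp (hankelRay θ c r) *
      hankelRay θ c r ^ ((-1 + -ν * n : ℝ) : ℂ) * exp (θ * I)) = exp (hankelRay θ c r) *
      hankelRay θ c r ^ ((-1 : ℝ) : ℂ) * exp (θ * I) *
      (-(s : ℂ) * hankelRay θ c r ^ ((-ν : ℝ) : ℂ)) ^ n := by
    rw [cpow_ofReal_add_mul_natCast (hp r), mul_pow]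
    push_cast
    ring
  have hgeom (r : ℝ) : HasSum (fun n : ℕ => Real.exp (c + r * Real.cos θ) *
      ‖hankelRay θ c r‖ ^ (-1 : ℝ) * q ^ n)
      (Real.exp (c + r * Real.cos θ) * ‖hankelRay θ c r‖ ^ (-1 : ℝ) * (1 - q)⁻¹) :=
    (hasSum_geometric_of_lt_one hq0 hq1).mul_left _
  have hsum := hasSum_integral_of_dominated_convergence (μ := volume.restrict (Ioi (0 : ℝ)))
    (F := fun (n : ℕ) r => (((-s) ^ n : ℝ) : ℂ) * (exp (hankelRay θ c r) *
      hankelRay θ c r ^ ((-1 + -ν * n : ℝ) : ℂ) * exp (θ * I)))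
    (f := fun r => exp (hankelRay θ c r) * hankelRay θ c r ^ ((ν - 1 : ℝ) : ℂ) * exp (θ * I) *
        (s + hankelRay θ c r ^ (ν : ℂ))⁻¹)
    (fun (n : ℕ) r => Real.exp (c + r * Real.cos θ) * ‖hankelRay θ c r‖ ^ (-1 : ℝ) * q ^ n)
    (fun n => ((continuousOn_hankelRay_cpow hs c _).aestronglyMeasurable
      measurableSet_Ioi).const_mul _)
    (fun n => ae_of_all _ fun r => ?_)
    (ae_of_all _ fun r => (hgeom r).summable) ?_
    (ae_of_all _ fun r => ?_)
  · have him := (hasSum_im hsum).mul_left Real.pi⁻¹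
    rw [← him.tsum_eq]
    refine tsum_congr fun n => ?_
    rw [integral_const_mul, im_ofReal_mul]
    change _ = Real.pi⁻¹ * (_ * (hankelIntegral θ c (-1 + -ν * n)).im)
    rw [im_hankelIntegral hθ hθ' hc, show -(-1 + -ν * n) = ν * n + 1 by ring,
      mul_left_comm, inv_mul_cancel_left₀ Real.pi_ne_zero, div_eq_mul_inv]
  · rw [hterm, norm_mul, norm_exp_mul_hankelRay_cpow, norm_pow]
    gcongr
    exact hratio r
  · simp only [fun r => (hgeom r).tsum_eq]
    exact (integrableOn_hankelRay_rpow hs hcos hc _).mul_const _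
  · simp only [hterm]
    have h0 : hankelRay θ c r ^ (ν : ℂ) ≠ 0 := by simp [cpow_eq_zero_iff, hp r]
    have h1 : hankelRay θ c r ^ ((ν - 1 : ℝ) : ℂ) =
        hankelRay θ c r ^ ((-1 : ℝ) : ℂ) * hankelRay θ c r ^ (ν : ℂ) := by
      rw [← cpow_add _ _ (hp r)]
      push_cast; ring_nf
    have h2 : (s : ℂ) + hankelRay θ c r ^ (ν : ℂ) =
        hankelRay θ c r ^ (ν : ℂ) * (1 - -(s : ℂ) * hankelRay θ c r ^ ((-ν : ℝ) : ℂ)) := by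
      rw [ofReal_neg, cpow_neg]
      field_simp
      ring
    have h3 : exp (hankelRay θ c r) * hankelRay θ c r ^ ((ν - 1 : ℝ) : ℂ) * exp (θ * I) *
        (s + hankelRay θ c r ^ (ν : ℂ))⁻¹ =
        exp (hankelRay θ c r) * hankelRay θ c r ^ ((-1 : ℝ) : ℂ) * exp (θ * I) *
          (1 - -(s : ℂ) * hankelRay θ c r ^ ((-ν : ℝ) : ℂ))⁻¹ := by
      rw [h1, h2, mul_inv]
      field_simp
    rw [h3]
    exact (hasSum_geometric_of_norm_lt_one ((hratio r).trans_lt hq1)).mul_left _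

theorem laplace_mainardiM (ν : ℝ) (hν0 : 0 < ν) (hν1 : ν < 1) (s : ℝ) :
    ∫ x in Set.Ioi (0 : ℝ), Real.exp (-s * x) * mainardiM ν x =
      mittagLeffler ν 1 (-s) := by
  have hpi := Real.pi_pos
  set θ : ℝ := Real.pi / (1 + ν) with hθdef
  have hθ : Real.pi / 2 < θ := div_lt_div_of_pos_left hpi (by linarith) (by linarith)
  have hθ' : θ < Real.pi := div_lt_self hpi (by linarith)
  have hνθ : θ * ν < Real.pi / 2 := by
    have : θ * (1 + ν) = Real.pi := div_mul_cancel₀ _ (by linarith)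
    linarith
  have hs : 0 < Real.sin θ := Real.sin_pos_of_pos_of_lt_pi (by linarith) hθ'
  have hcos : Real.cos θ < 0 := Real.cos_neg_of_pi_div_two_lt_of_lt hθ (by linarith)
  have hcosν : 0 < Real.cos (θ * ν) := Real.cos_pos_of_mem_Ioo
    ⟨by linarith [mul_pos (half_pos hpi |>.trans hθ) hν0], hνθ⟩
  obtain ⟨c, hcs, hc⟩ : ∃ c : ℝ, |s| < (c * Real.sin θ) ^ ν * Real.cos (θ * ν) ∧ 0 < c := by
    have : Tendsto (fun c : ℝ => (c * Real.sin θ) ^ ν * Real.cos (θ * ν)) atTop atTop :=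
      ((tendsto_rpow_atTop hν0).comp (tendsto_id.atTop_mul_const hs)).atTop_mul_const hcosν
    exact ((this.eventually_gt_atTop |s|).and (eventually_gt_atTop 0)).exists
  set m : ℝ := (c * Real.sin θ) ^ ν * Real.cos (θ * ν) with hm
  have hms : 0 < m + s := by linarith [neg_abs_le s]
  have hre (r : ℝ) (hr : 0 ≤ r) : m ≤ (hankelRay θ c r ^ (ν : ℂ)).re :=
    le_re_hankelRay_cpow (by linarith) hθ' hc hr hν0 hνθ
  set g : ℝ → ℂ := fun r =>
    exp (hankelRay θ c r) * hankelRay θ c r ^ ((ν - 1 : ℝ) : ℂ) * exp (θ * I) with hg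
  have hgi : IntegrableOn g (Ioi 0) := integrableOn_hankelRay_cpow hs hcos hc _
  have hpν : AEStronglyMeasurable (fun r => hankelRay θ c r ^ (ν : ℂ))
      (volume.restrict (Ioi (0 : ℝ))) :=
    ((continuous_hankelRay θ c).continuousOn.cpow_const fun r hr =>
      hankelRay_mem_slitPlane hs hr).aestronglyMeasurable measurableSet_Ioi
  set f : ℝ → ℝ → ℂ := fun x r => g r * exp (-(s + hankelRay θ c r ^ (ν : ℂ)) * x) with hf
  have hfi : Integrable (Function.uncurry f)
      ((volume.restrict (Ioi (0 : ℝ))).prod (volume.restrict (Ioi (0 : ℝ)))) := by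
    refine ((exp_neg_integrableOn_Ioi 0 hms).integrable.mul_prod hgi.norm).mono' ?_ ?_
    · refine hgi.aestronglyMeasurable.comp_snd.mul (continuous_exp.comp_aestronglyMeasurable ?_)
      refine ((hpν.comp_snd).const_add (s : ℂ)).neg.mul ?_
      exact (continuous_ofReal.comp continuous_fst).aestronglyMeasurable
    · rw [Measure.prod_restrict]
      refine (ae_restrict_iff' (measurableSet_Ioi.prod measurableSet_Ioi)).2
        (ae_of_all _ fun z hz => ?_)
      obtain ⟨hx, hr⟩ := hz
      have hx' : 0 < z.1 := hx
      have hr' : 0 < z.2 := hr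
      rw [Function.uncurry, norm_mul, mul_comm, norm_exp]
      refine mul_le_mul_of_nonneg_right (Real.exp_le_exp.2 ?_) (norm_nonneg _)
      rw [re_mul_ofReal, neg_re, add_re, ofReal_re]
      exact mul_le_mul_of_nonneg_right (by linarith [hre z.2 hr'.le]) hx'.le
  have hinner (r : ℝ) (hr : r ∈ Ioi (0 : ℝ)) :
      ∫ x in Ioi (0 : ℝ), f x r = g r * (s + hankelRay θ c r ^ (ν : ℂ))⁻¹ := by
    have hr' : 0 < r := hr
    rw [integral_const_mul, integral_exp_mul_complex_Ioi]
    · rw [ofReal_zero, mul_zero, exp_zero, neg_div_neg_eq, one_div]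
    · rw [neg_re, add_re, ofReal_re]
      linarith [hre r hr'.le]
  calc ∫ x in Ioi (0 : ℝ), Real.exp (-s * x) * mainardiM ν x
      = ∫ x in Ioi (0 : ℝ), Real.pi⁻¹ * (∫ r in Ioi (0 : ℝ), f x r).im := by
        refine integral_congr_ae (ae_of_all _ fun x => ?_)
        simp only
        rw [mainardiM_eq_im_integral hθ hθ' hc hν1, mul_left_comm, ← im_ofReal_mul,
          ← integral_const_mul]
        congr 3
        ext r
        simp only [hf, hg]
        rw [show -((s : ℂ) + hankelRay θ c r ^ (ν : ℂ)) * x =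
          ((-s * x : ℝ) : ℂ) + -x * hankelRay θ c r ^ (ν : ℂ) by push_cast; ring, exp_add,
          ofReal_exp]
        ring
    _ = Real.pi⁻¹ * (∫ x in Ioi (0 : ℝ), ∫ r in Ioi (0 : ℝ), f x r).im := by
        rw [integral_const_mul]
        congr 1
        exact integral_im hfi.integral_prod_left
    _ = Real.pi⁻¹ * (∫ r in Ioi (0 : ℝ), g r * (s + hankelRay θ c r ^ (ν : ℂ))⁻¹).im := by
        rw [integral_integral_swap hfi, setIntegral_congr_fun measurableSet_Ioi hinner]
    _ = mittagLeffler ν 1 (-s) := by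
        refine (mittagLeffler_neg_eq_im_integral hθ hθ' hc hν0 (hcs.trans_le ?_)).symm
        exact mul_le_of_le_one_right (by positivity) (Real.cos_le_one _)
end

section
/- For every 0 < ν < 1 and every x ≥ 0, one has M_ν(x) ≥ 0; hence M_ν is a probability density on the positive real axis. -/
open Filter Topology
open Finset.HasAntidiagonal (antidiagonal)

/-- `(-1)^N * binom(s-1, N)`, the coefficient of `z^N` in `(1 - z)^(s - 1)`. -/
noncomputable def powCoeff (s : ℝ) (N : ℕ) : ℝ :=
  ∏ i ∈ Finset.range N, (1 - s / ((i : ℝ) + 1))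

theorem powCoeff_zero_right (s : ℝ) : powCoeff s 0 = 1 := by simp [powCoeff]

theorem powCoeff_zero_left (N : ℕ) : powCoeff 0 N = 1 := by simp [powCoeff]

theorem powCoeff_succ (s : ℝ) (N : ℕ) :
    powCoeff s (N + 1) = powCoeff s N * (1 - s / ((N : ℝ) + 1)) := by
  simp [powCoeff, Finset.prod_range_succ]

theorem succ_mul_powCoeff_succ (s : ℝ) (N : ℕ) :
    ((N : ℝ) + 1) * powCoeff s (N + 1) = (N + 1 - s) * powCoeff s N := by
  rw [powCoeff_succ]
  have : (N : ℝ) + 1 ≠ 0 := by positivity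
  field_simp

theorem one_sub_div_nonneg {s : ℝ} {N : ℕ} (h : s ≤ N + 1) : 0 ≤ 1 - s / ((N : ℝ) + 1) := by
  rw [sub_nonneg, div_le_one (by positivity)]
  exact h

theorem powCoeff_nonneg {s : ℝ} (hs : s ≤ 1) (N : ℕ) : 0 ≤ powCoeff s N := by
  refine Finset.prod_nonneg fun i _ => one_sub_div_nonneg ?_
  have : (0 : ℝ) ≤ i := by positivity
  linarith

theorem powCoeff_antitone {s : ℝ} (hs₀ : 0 ≤ s) (hs : s ≤ 1) : Antitone (powCoeff s) := by
  refine antitone_nat_of_succ_le fun N => ?_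
  rw [powCoeff_succ]
  refine mul_le_of_le_one_right (powCoeff_nonneg hs N) ?_
  have : 0 ≤ s / ((N : ℝ) + 1) := by positivity
  linarith

theorem powCoeff_one_add_succ_nonpos {ν : ℝ} (h₀ : 0 ≤ ν) (h₁ : ν ≤ 1) (N : ℕ) :
    powCoeff (ν + 1) (N + 1) ≤ 0 := by
  induction N with
  | zero => simp [powCoeff]; linarith
  | succ N ih =>
    rw [powCoeff_succ]
    refine mul_nonpos_of_nonpos_of_nonneg ih (one_sub_div_nonneg ?_)
    have : (0 : ℝ) ≤ N := by positivity
    push_cast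
    linarith

/-- The Chu–Vandermonde identity. -/
theorem sum_antidiagonal_powCoeff_mul (a b : ℝ) (N : ℕ) :
    ∑ p ∈ antidiagonal N, powCoeff a p.1 * powCoeff b p.2 = powCoeff (a + b - 1) N := by
  induction N with
  | zero => simp [powCoeff]
  | succ N ih =>
    have hN : (N : ℝ) + 1 ≠ 0 := by positivity
    refine mul_left_cancel₀ hN ?_
    rw [succ_mul_powCoeff_succ, ← ih, Finset.mul_sum, Finset.mul_sum]
    have h1 : ∑ p ∈ antidiagonal (N + 1), ((N : ℝ) + 1) * (powCoeff a p.1 * powCoeff b p.2)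
        = ∑ p ∈ antidiagonal (N + 1), ((p.1 : ℝ) * powCoeff a p.1) * powCoeff b p.2
        + ∑ p ∈ antidiagonal (N + 1), powCoeff a p.1 * ((p.2 : ℝ) * powCoeff b p.2) := by
      rw [← Finset.sum_add_distrib]
      refine Finset.sum_congr rfl fun p hp => ?_
      have : (p.1 : ℝ) + p.2 = N + 1 := by exact_mod_cast Finset.HasAntidiagonal.mem_antidiagonal.1 hp
      rw [← this]
      ring
    rw [h1, Finset.Nat.sum_antidiagonal_succ, Finset.Nat.sum_antidiagonal_succ']
    simp only [Nat.cast_zero, zero_mul, mul_zero, zero_add, Nat.cast_add, Nat.cast_one,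
      succ_mul_powCoeff_succ]
    rw [← Finset.sum_add_distrib]
    refine Finset.sum_congr rfl fun p hp => ?_
    have : (p.1 : ℝ) + p.2 = N := by exact_mod_cast Finset.HasAntidiagonal.mem_antidiagonal.1 hp
    rw [← this]
    ring

/-- The coefficient of `z^N` in `(1 - (1 - z)^ν)^k * (1 - z)^(s - 1)`. -/
noncomputable def subPowCoeff (ν : ℝ) : ℕ → ℝ → ℕ → ℝ
  | 0, s, N => powCoeff s N
  | k + 1, s, N => subPowCoeff ν k s N - subPowCoeff ν k (s + ν) N

theorem subPowCoeff_add (ν : ℝ) (k : ℕ) (s : ℝ) (N : ℕ) :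
    subPowCoeff ν k (s + ν) N =
      ∑ p ∈ antidiagonal N, powCoeff (ν + 1) p.1 * subPowCoeff ν k s p.2 := by
  induction k generalizing s with
  | zero =>
    simp only [subPowCoeff, sum_antidiagonal_powCoeff_mul]
    congr 1
    ring
  | succ k ih => simp only [subPowCoeff, ih, mul_sub, Finset.sum_sub_distrib]

theorem subPowCoeff_succ_zero (ν : ℝ) (k : ℕ) (s : ℝ) : subPowCoeff ν (k + 1) s 0 = 0 := by
  rw [subPowCoeff, subPowCoeff_add]
  simp [powCoeff]

theorem subPowCoeff_succ_succ (ν : ℝ) (k : ℕ) (s : ℝ) (N : ℕ) :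
    subPowCoeff ν (k + 1) s (N + 1) =
      ∑ p ∈ antidiagonal N, -powCoeff (ν + 1) (p.1 + 1) * subPowCoeff ν k s p.2 := by
  rw [subPowCoeff, subPowCoeff_add, Finset.Nat.sum_antidiagonal_succ]
  simp [powCoeff_zero_right]

theorem subPowCoeff_nonneg {ν : ℝ} (h₀ : 0 ≤ ν) (h₁ : ν ≤ 1) {s : ℝ} (hs : s ≤ 1) (k N : ℕ) :
    0 ≤ subPowCoeff ν k s N := by
  induction k generalizing N with
  | zero => exact powCoeff_nonneg hs N
  | succ k ih =>
    cases N with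
    | zero => rw [subPowCoeff_succ_zero]
    | succ N =>
      rw [subPowCoeff_succ_succ]
      exact Finset.sum_nonneg fun p _ =>
        mul_nonneg (neg_nonneg.2 (powCoeff_one_add_succ_nonpos h₀ h₁ _)) (ih _)

theorem subPowCoeff_zero_le {ν : ℝ} (h₀ : 0 ≤ ν) (h₁ : ν ≤ 1) (k N : ℕ) :
    subPowCoeff ν k 0 N ≤ (1 - powCoeff ν N) ^ k := by
  have hp : ∀ N, powCoeff ν N ≤ 1 := fun N => by
    simpa [powCoeff_zero_right] using powCoeff_antitone h₀ h₁ (Nat.zero_le N)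
  induction k generalizing N with
  | zero => simp [subPowCoeff, powCoeff_zero_left]
  | succ k ih =>
    cases N with
    | zero => simp [subPowCoeff_succ_zero, powCoeff_zero_right]
    | succ N =>
      have h : ∑ p ∈ antidiagonal N, -powCoeff (ν + 1) (p.1 + 1)
          = 1 - powCoeff ν (N + 1) := by
        have := subPowCoeff_succ_succ ν 0 0 N
        simpa [subPowCoeff, powCoeff_zero_left] using this.symm
      rw [subPowCoeff_succ_succ, pow_succ', ← h, Finset.sum_mul, h]
      refine Finset.sum_le_sum fun p hpN => ?_
      refine mul_le_mul_of_nonneg_left ((ih p.2).trans ?_)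
        (neg_nonneg.2 (powCoeff_one_add_succ_nonpos h₀ h₁ _))
      refine pow_le_pow_left₀ (sub_nonneg.2 (hp _)) (sub_le_sub_left ?_ _) k
      refine powCoeff_antitone h₀ h₁ ?_
      have := Finset.HasAntidiagonal.mem_antidiagonal.1 hpN
      omega

theorem subPowCoeff_eq_sum (ν : ℝ) (k : ℕ) (s : ℝ) (N : ℕ) {L : ℕ} (hL : k < L) :
    subPowCoeff ν k s N =
      ∑ j ∈ Finset.range L, (-1) ^ j * (k.choose j : ℝ) * powCoeff (s + ν * j) N := by
  induction k generalizing s L with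
  | zero =>
    obtain ⟨L, rfl⟩ := Nat.exists_eq_succ_of_ne_zero hL.ne'
    simp [Finset.sum_range_succ', subPowCoeff]
  | succ k ih =>
    obtain ⟨L, rfl⟩ := Nat.exists_eq_succ_of_ne_zero (Nat.ne_zero_of_lt hL)
    rw [subPowCoeff, ih s (show k < L + 1 by omega), ih (s + ν) (show k < L by omega),
      Finset.sum_range_succ', Finset.sum_range_succ', add_sub_right_comm, ← Finset.sum_sub_distrib]
    congr 1
    · refine Finset.sum_congr rfl fun j _ => ?_
      rw [Nat.choose_succ_succ, show s + ν + ν * (j : ℝ) = s + ν * ((j + 1 : ℕ) : ℝ) by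
        push_cast; ring]
      push_cast
      ring
    · simp

theorem subPowCoeff_eq_tsum (ν : ℝ) (k : ℕ) (s : ℝ) (N : ℕ) :
    subPowCoeff ν k s N = ∑' j : ℕ, (-1) ^ j * (k.choose j : ℝ) * powCoeff (s + ν * j) N := by
  rw [subPowCoeff_eq_sum ν k s N k.lt_succ_self, tsum_eq_sum]
  intro j hj
  rw [Nat.choose_eq_zero_of_lt (by simpa using hj)]
  simp

theorem abs_powCoeff_le_exp {s : ℝ} (N : ℕ) (h : (N : ℝ) ≤ s) :
    |powCoeff s N| ≤ Real.exp s := by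
  have hs : 0 ≤ s := le_trans (by positivity) h
  refine le_trans ?_ (Real.pow_div_factorial_le_exp s hs N)
  induction N with
  | zero => simp [powCoeff]
  | succ N ih =>
    push_cast at h
    rw [powCoeff_succ, abs_mul, pow_succ, Nat.factorial_succ, Nat.cast_mul,
      mul_comm (_ : ℝ) (N.factorial : ℝ), mul_div_mul_comm]
    refine mul_le_mul (ih (by linarith)) ?_ (abs_nonneg _) (by positivity)
    have : 1 ≤ s / ((N : ℝ) + 1) := by rwa [one_le_div (by positivity)]
    rw [abs_of_nonpos (by linarith)]
    push_cast
    linarith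

theorem abs_powCoeff_mul_rpow_le {s : ℝ} (hs : 0 ≤ s) (N : ℕ) :
    |powCoeff s N| * ((N : ℝ) + 1) ^ s ≤ Real.exp s * (s + 1) ^ s := by
  by_cases h : (N : ℝ) ≤ s
  · gcongr
    exact abs_powCoeff_le_exp N h
  induction N with
  | zero => exact absurd hs (by simpa using h)
  | succ N ih =>
    push_cast at h ⊢
    have hN : (0 : ℝ) < (N : ℝ) + 1 := by positivity
    have hle : |powCoeff s N| * ((N : ℝ) + 1) ^ s ≤ Real.exp s * (s + 1) ^ s := by
      by_cases h' : (N : ℝ) ≤ s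
      · gcongr
        exact abs_powCoeff_le_exp N h'
      · exact ih h'
    refine le_trans ?_ hle
    rw [powCoeff_succ, abs_mul, mul_assoc, abs_of_nonneg (one_sub_div_nonneg (by linarith))]
    refine mul_le_mul_of_nonneg_left ?_ (abs_nonneg _)
    have h1 : 1 - s / ((N : ℝ) + 1) ≤ Real.exp (-(s / (N + 1))) := by
      have := Real.add_one_le_exp (-(s / ((N : ℝ) + 1)))
      linarith
    have h2 : ((N : ℝ) + 1 + 1) ^ s ≤ Real.exp (s / (N + 1)) * ((N : ℝ) + 1) ^ s := by
      have : (N : ℝ) + 1 + 1 = (1 / (N + 1) + 1) * (N + 1) := by field_simp; ring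
      rw [this, Real.mul_rpow (by positivity) (by positivity)]
      gcongr
      rw [show s / ((N : ℝ) + 1) = 1 / (N + 1) * s by ring, Real.exp_mul]
      gcongr
      exact Real.add_one_le_exp _
    calc (1 - s / ((N : ℝ) + 1)) * ((N : ℝ) + 1 + 1) ^ s
        ≤ Real.exp (-(s / (N + 1))) * (Real.exp (s / (N + 1)) * ((N : ℝ) + 1) ^ s) :=
          mul_le_mul h1 h2 (by positivity) (Real.exp_pos _).le
      _ = ((N : ℝ) + 1) ^ s := by rw [← mul_assoc, ← Real.exp_add]; simp

theorem tendsto_rpow_mul_powCoeff (s : ℝ) :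
    Tendsto (fun n : ℕ => (n : ℝ) ^ s * powCoeff s (n + 1)) atTop (𝓝 (Real.Gamma (1 - s))⁻¹) := by
  have hprod : ∀ N, powCoeff s N = (∏ j ∈ Finset.range N, (1 - s + (j : ℝ))) / N.factorial := by
    intro N
    rw [powCoeff, ← Finset.prod_range_add_one_eq_factorial, Nat.cast_prod,
      ← Finset.prod_div_distrib]
    refine Finset.prod_congr rfl fun i _ => ?_
    push_cast
    field_simp
    ring
  by_cases hG : Real.Gamma (1 - s) = 0
  · obtain ⟨m, hm⟩ := Real.Gamma_eq_zero_iff _ |>.1 hG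
    rw [hG, inv_zero]
    refine tendsto_const_nhds.congr' ?_
    filter_upwards [eventually_ge_atTop m] with n hn
    rw [hprod, Finset.prod_eq_zero (i := m) (by simp; omega) (by rw [hm]; ring)]
    simp
  · have h1 := ((Real.GammaSeq_tendsto_Gamma (1 - s)).inv₀ hG).mul
      (tendsto_natCast_div_add_atTop (1 : ℝ))
    rw [mul_one] at h1
    refine h1.congr' ?_
    filter_upwards [eventually_ge_atTop 1] with n hn
    have hn' : (0 : ℝ) < n := by exact_mod_cast hn
    rw [hprod, Real.GammaSeq, Real.rpow_sub hn', Real.rpow_one, Nat.factorial_succ, inv_div]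
    have : (n : ℝ) ^ s ≠ 0 := by positivity
    have : (n.factorial : ℝ) ≠ 0 := by positivity
    push_cast
    field_simp

theorem rpow_mul_abs_powCoeff_le {ν s : ℝ} (hν₀ : 0 ≤ ν) (hν₁ : ν ≤ 1) (hs₀ : 0 ≤ s) (hs₁ : s ≤ 1)
    (j n : ℕ) :
    (n : ℝ) ^ (s + ν * j) * |powCoeff (s + ν * j) (n + 1)| ≤
      Real.exp (j + 1) * ((j : ℝ) + 2) ^ (1 + ν * j) := by
  have hj : (0 : ℝ) ≤ j := by positivity
  have hνj : ν * j ≤ j := mul_le_of_le_one_left hj hν₁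
  have h0 : 0 ≤ s + ν * j := by positivity
  calc (n : ℝ) ^ (s + ν * j) * |powCoeff (s + ν * j) (n + 1)|
      ≤ |powCoeff (s + ν * j) (n + 1)| * (((n + 1 : ℕ) : ℝ) + 1) ^ (s + ν * j) := by
        rw [mul_comm]
        gcongr
        push_cast
        linarith
    _ ≤ Real.exp (s + ν * j) * (s + ν * j + 1) ^ (s + ν * j) := abs_powCoeff_mul_rpow_le h0 _
    _ ≤ Real.exp (j + 1) * ((j : ℝ) + 2) ^ (s + ν * j) := by
        gcongr ?_ * ?_
        · exact Real.exp_le_exp.2 (by linarith)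
        · exact Real.rpow_le_rpow (by linarith) (by linarith) h0
    _ ≤ Real.exp (j + 1) * ((j : ℝ) + 2) ^ (1 + ν * j) := by
        gcongr
        linarith

theorem abs_inv_Gamma_one_sub_le {ν s : ℝ} (hν₀ : 0 ≤ ν) (hν₁ : ν ≤ 1) (hs₀ : 0 ≤ s)
    (hs₁ : s ≤ 1) (j : ℕ) :
    |(Real.Gamma (1 - (s + ν * j)))⁻¹| ≤ Real.exp (j + 1) * ((j : ℝ) + 2) ^ (1 + ν * j) := by
  refine le_of_tendsto (tendsto_rpow_mul_powCoeff (s + ν * j)).abs (.of_forall fun n => ?_)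
  rw [abs_mul, abs_of_nonneg (by positivity)]
  exact rpow_mul_abs_powCoeff_le hν₀ hν₁ hs₀ hs₁ j n

theorem summable_pow_mul_factorial_rpow {ν : ℝ} (hν : ν < 1) {a : ℝ} (ha : 0 < a) :
    Summable fun j : ℕ => a ^ j * (j.factorial : ℝ) ^ (ν - 1) := by
  have hpos : ∀ j : ℕ, 0 < a ^ j * (j.factorial : ℝ) ^ (ν - 1) := fun j => by positivity
  refine summable_of_ratio_test_tendsto_lt_one zero_lt_one (.of_forall fun j => (hpos j).ne') ?_
  have h : Tendsto (fun j : ℕ => a * ((j + 1 : ℕ) : ℝ) ^ (-(1 - ν))) atTop (𝓝 (a * 0)) :=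
    ((tendsto_rpow_neg_atTop (by linarith)).comp
      (tendsto_natCast_atTop_atTop.comp (tendsto_add_atTop_nat 1))).const_mul a
  rw [mul_zero] at h
  refine h.congr fun j => ?_
  rw [Real.norm_of_nonneg (hpos _).le, Real.norm_of_nonneg (hpos _).le, eq_div_iff (hpos j).ne',
    Nat.factorial_succ, Nat.cast_mul, Real.mul_rpow (by positivity) (by positivity), pow_succ,
    neg_sub]
  ring

theorem summable_wright_majorant {ν : ℝ} (hν₀ : 0 ≤ ν) (hν₁ : ν < 1) {x : ℝ} (hx : 0 ≤ x) :
    Summable fun j : ℕ =>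
      x ^ j / j.factorial * (Real.exp (j + 1) * ((j : ℝ) + 2) ^ (1 + ν * j)) := by
  set a : ℝ := 2 * Real.exp 2 * (x + 1) with ha
  refine Summable.of_nonneg_of_le (fun j => by positivity) (fun j => ?_)
    ((summable_pow_mul_factorial_rpow hν₁ (show 0 < a by positivity)).mul_left
      (2 * Real.exp 3))
  have hf : (0 : ℝ) < j.factorial := by positivity
  have h1 : ((j : ℝ) + 2) ^ j ≤ Real.exp (j + 2) * j.factorial :=
    (div_le_iff₀ hf).1 (Real.pow_div_factorial_le_exp _ (by positivity) j)
  have h2 : (j : ℝ) + 2 ≤ 2 * 2 ^ j := by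
    have : j + 2 ≤ 2 * 2 ^ j := by
      clear h1 hf
      induction j with
      | zero => norm_num
      | succ j ih => rw [pow_succ]; have := Nat.one_le_two_pow (n := j); grind
    exact_mod_cast this
  have h3 : ((j : ℝ) + 2) ^ (1 + ν * j) ≤
      (2 * 2 ^ j) * (Real.exp (j + 2) * (j.factorial : ℝ) ^ ν) := by
    rw [Real.rpow_add (by positivity), Real.rpow_one, mul_comm ν, Real.rpow_mul (by positivity),
      Real.rpow_natCast]
    gcongr
    calc (((j : ℝ) + 2) ^ j) ^ ν ≤ (Real.exp (j + 2) * j.factorial) ^ ν := by gcongr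
      _ = Real.exp (j + 2) ^ ν * (j.factorial : ℝ) ^ ν :=
        Real.mul_rpow (by positivity) (by positivity)
      _ ≤ Real.exp (j + 2) * (j.factorial : ℝ) ^ ν := by
        gcongr
        exact Real.rpow_le_self_of_one_le (Real.one_le_exp (by positivity)) hν₁.le
  calc x ^ j / j.factorial * (Real.exp (j + 1) * ((j : ℝ) + 2) ^ (1 + ν * j))
      ≤ (x + 1) ^ j / j.factorial *
        (Real.exp (j + 1) * ((2 * 2 ^ j) * (Real.exp (j + 2) * (j.factorial : ℝ) ^ ν))) := by
        gcongr
        linarith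
    _ = 2 * Real.exp 3 * (a ^ j * (j.factorial : ℝ) ^ (ν - 1)) := by
        have he : Real.exp (j + 1) * Real.exp (j + 2) = Real.exp 3 * Real.exp 2 ^ j := by
          rw [← Real.exp_add, ← Real.exp_nat_mul, ← Real.exp_add]
          ring_nf
        rw [ha, mul_pow, mul_pow, Real.rpow_sub hf, Real.rpow_one]
        linear_combination ((x + 1) ^ j / j.factorial * (2 * 2 ^ j) * (j.factorial : ℝ) ^ ν) * he

theorem norm_wright_term_le {ν s : ℝ} (hν₀ : 0 ≤ ν) (hν₁ : ν ≤ 1) (hs₀ : 0 ≤ s) (hs₁ : s ≤ 1)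
    {x r : ℝ} (hx : |x| ≤ r) (j : ℕ) :
    ‖x ^ j / (j.factorial * Real.Gamma (-ν * j + (1 - s)))‖ ≤
      r ^ j / j.factorial * (Real.exp (j + 1) * ((j : ℝ) + 2) ^ (1 + ν * j)) := by
  rw [show -ν * j + (1 - s) = 1 - (s + ν * j) by ring, ← div_div, div_eq_mul_inv _ (Real.Gamma _),
    norm_mul, norm_div, norm_pow, Real.norm_eq_abs, Real.norm_natCast]
  have hr : 0 ≤ r := (abs_nonneg x).trans hx
  gcongr
  exact abs_inv_Gamma_one_sub_le hν₀ hν₁ hs₀ hs₁ j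

theorem summable_wright_term {ν s : ℝ} (hν₀ : 0 ≤ ν) (hν₁ : ν < 1) (hs₀ : 0 ≤ s) (hs₁ : s ≤ 1)
    (x : ℝ) : Summable fun j : ℕ => x ^ j / (j.factorial * Real.Gamma (-ν * j + (1 - s))) :=
  .of_norm_bounded (summable_wright_majorant hν₀ hν₁ (abs_nonneg x)) fun j =>
    norm_wright_term_le hν₀ hν₁.le hs₀ hs₁ le_rfl j

theorem tendsto_choose_mul_pow_of_tendsto_mul {k : ℕ → ℕ} {q : ℕ → ℝ} {x : ℝ}
    (hkq : Tendsto (fun n => (k n : ℝ) * q n) atTop (𝓝 x)) (hq : Tendsto q atTop (𝓝 0)) (j : ℕ) :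
    Tendsto (fun n => ((k n).choose j : ℝ) * q n ^ j) atTop (𝓝 (x ^ j / j.factorial)) := by
  have h : Tendsto (fun n => ∏ i ∈ Finset.range j, ((k n : ℝ) * q n - i * q n)) atTop
      (𝓝 (∏ i ∈ Finset.range j, (x - i * 0))) :=
    tendsto_finsetProd _ fun i _ => hkq.sub (hq.const_mul _)
  simp only [mul_zero, sub_zero, Finset.prod_const, Finset.card_range] at h
  refine (h.div_const (j.factorial : ℝ)).congr fun n => ?_
  have : (j.factorial : ℝ) ≠ 0 := by positivity
  rw [div_eq_iff this, mul_right_comm, mul_comm (_ : ℝ) (j.factorial : ℝ), ← Nat.cast_mul,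
    ← Nat.descFactorial_eq_factorial_mul_choose, ← descPochhammer_eval_eq_descFactorial,
    descPochhammer_eval_eq_prod_range, ← Finset.card_range j, ← Finset.prod_const,
    Finset.card_range, ← Finset.prod_mul_distrib]
  exact Finset.prod_congr rfl fun i _ => by ring

theorem tendsto_floor_mul_rpow_mul_rpow_neg {ν x : ℝ} (hν : 0 < ν) (hx : 0 ≤ x) :
    Tendsto (fun n : ℕ => (⌊x * (n : ℝ) ^ ν⌋₊ : ℝ) * (n : ℝ) ^ (-ν)) atTop (𝓝 x) := by
  refine ((tendsto_nat_floor_mul_div_atTop hx).comp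
    ((tendsto_rpow_atTop hν).comp tendsto_natCast_atTop_atTop)).congr fun n => ?_
  simp [Real.rpow_neg, div_eq_mul_inv]

theorem tendsto_rpow_mul_subPowCoeff {ν s x : ℝ} (hν₀ : 0 < ν) (hν₁ : ν < 1) (hs₀ : 0 ≤ s)
    (hs₁ : s ≤ 1) (hx : 0 ≤ x) :
    Tendsto (fun n : ℕ => (n : ℝ) ^ s * subPowCoeff ν ⌊x * (n : ℝ) ^ ν⌋₊ s (n + 1)) atTop
      (𝓝 (wright (-ν) (1 - s) (-x))) := by
  have hq : Tendsto (fun n : ℕ => (n : ℝ) ^ (-ν)) atTop (𝓝 0) :=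
    (tendsto_rpow_neg_atTop hν₀).comp tendsto_natCast_atTop_atTop
  have key := tendsto_tsum_of_dominated_convergence (𝓕 := atTop)
    (f := fun (n j : ℕ) => (-1) ^ j * ((⌊x * (n : ℝ) ^ ν⌋₊.choose j : ℝ) * ((n : ℝ) ^ (-ν)) ^ j) *
      ((n : ℝ) ^ (s + ν * j) * powCoeff (s + ν * j) (n + 1)))
    (g := fun j : ℕ => (-x) ^ j / (j.factorial * Real.Gamma (-ν * j + (1 - s))))
    (summable_wright_majorant hν₀.le hν₁ hx) (fun j => ?_) ?_
  · rw [wright]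
    refine key.congr' ?_
    filter_upwards [eventually_ge_atTop 1] with n hn
    have hn' : (0 : ℝ) < n := by exact_mod_cast hn
    rw [subPowCoeff_eq_tsum, ← tsum_mul_left]
    refine tsum_congr fun j => ?_
    have : ((n : ℝ) ^ (-ν)) ^ j * (n : ℝ) ^ (s + ν * j) = (n : ℝ) ^ s := by
      rw [← Real.rpow_mul_natCast hn'.le, ← Real.rpow_add hn']
      ring_nf
    rw [← this]
    ring
  · have h := ((tendsto_choose_mul_pow_of_tendsto_mul
      (tendsto_floor_mul_rpow_mul_rpow_neg hν₀ hx) hq j).const_mul ((-1) ^ j)).mul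
      (tendsto_rpow_mul_powCoeff (s + ν * j))
    convert h using 2
    rw [show -ν * j + (1 - s) = 1 - (s + ν * j) by ring, neg_pow x, ← div_div, mul_div_assoc,
      div_eq_mul_inv _ (Real.Gamma _)]
  · filter_upwards [eventually_ge_atTop 1] with n hn j
    have hn' : (0 : ℝ) < n := by exact_mod_cast hn
    rw [norm_mul, norm_mul, norm_pow, norm_neg, norm_one, one_pow, one_mul,
      Real.norm_of_nonneg (by positivity), Real.norm_eq_abs, abs_mul,
      abs_of_nonneg (a := (n : ℝ) ^ (s + ν * j)) (by positivity)]
    refine mul_le_mul ?_ (rpow_mul_abs_powCoeff_le hν₀.le hν₁.le hs₀ hs₁ j n) (by positivity)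
      (by positivity)
    calc (⌊x * (n : ℝ) ^ ν⌋₊.choose j : ℝ) * ((n : ℝ) ^ (-ν)) ^ j
        ≤ (x * (n : ℝ) ^ ν) ^ j / j.factorial * ((n : ℝ) ^ (-ν)) ^ j := by
          gcongr
          refine (Nat.choose_le_pow_div j _).trans ?_
          gcongr
          exact Nat.floor_le (by positivity)
      _ = x ^ j / j.factorial := by
          rw [div_mul_eq_mul_div, ← mul_pow, mul_assoc, ← Real.rpow_add hn']
          simp

theorem wright_nonneg {ν s x : ℝ} (hν₀ : 0 < ν) (hν₁ : ν < 1) (hs₀ : 0 ≤ s) (hs₁ : s ≤ 1)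
    (hx : 0 ≤ x) : 0 ≤ wright (-ν) (1 - s) (-x) :=
  ge_of_tendsto' (tendsto_rpow_mul_subPowCoeff hν₀ hν₁ hs₀ hs₁ hx) fun n =>
    mul_nonneg (by positivity) (subPowCoeff_nonneg hν₀.le hν₁.le hs₁ _ _)

theorem wright_one_le_exp {ν x : ℝ} (hν₀ : 0 < ν) (hν₁ : ν < 1) (hx : 0 ≤ x) :
    wright (-ν) 1 (-x) ≤ Real.exp (-(x * (Real.Gamma (1 - ν))⁻¹)) := by
  have h1 := tendsto_rpow_mul_subPowCoeff hν₀ hν₁ le_rfl zero_le_one hx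
  have h2 : Tendsto (fun n : ℕ => Real.exp (-(((⌊x * (n : ℝ) ^ ν⌋₊ : ℝ) * (n : ℝ) ^ (-ν)) *
      ((n : ℝ) ^ ν * powCoeff ν (n + 1))))) atTop
      (𝓝 (Real.exp (-(x * (Real.Gamma (1 - ν))⁻¹)))) :=
    (Real.continuous_exp.tendsto _).comp
      ((tendsto_floor_mul_rpow_mul_rpow_neg hν₀ hx).mul (tendsto_rpow_mul_powCoeff ν)).neg
  rw [sub_zero] at h1
  refine le_of_tendsto_of_tendsto h1 h2 ?_
  filter_upwards [eventually_ge_atTop 1] with n hn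
  have hn' : (0 : ℝ) < n := by exact_mod_cast hn
  rw [Real.rpow_zero, one_mul]
  refine (subPowCoeff_zero_le hν₀.le hν₁.le _ _).trans ?_
  have hp : powCoeff ν (n + 1) ≤ 1 := by
    simpa [powCoeff_zero_right] using powCoeff_antitone hν₀.le hν₁.le (Nat.zero_le (n + 1))
  have hc : (n : ℝ) ^ (-ν) * (n : ℝ) ^ ν = 1 := by rw [← Real.rpow_add hn']; simp
  refine (pow_le_pow_left₀ (sub_nonneg.2 hp) (Real.one_sub_le_exp_neg _) _).trans_eq ?_
  rw [← Real.exp_nat_mul]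
  congr 1
  linear_combination ((⌊x * (n : ℝ) ^ ν⌋₊ : ℝ) * powCoeff ν (n + 1)) * hc

theorem tendsto_wright_one_neg_atTop {ν : ℝ} (hν₀ : 0 < ν) (hν₁ : ν < 1) :
    Tendsto (fun x => wright (-ν) 1 (-x)) atTop (𝓝 0) := by
  have hG : 0 < (Real.Gamma (1 - ν))⁻¹ := inv_pos.2 (Real.Gamma_pos_of_pos (by linarith))
  have h : Tendsto (fun x => Real.exp (-(x * (Real.Gamma (1 - ν))⁻¹))) atTop (𝓝 0) :=
    Real.tendsto_exp_neg_atTop_nhds_zero.comp (tendsto_id.atTop_mul_const hG)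
  refine tendsto_of_tendsto_of_tendsto_of_le_of_le' tendsto_const_nhds h ?_ ?_
  · filter_upwards [eventually_ge_atTop 0] with x hx
    simpa using wright_nonneg hν₀ hν₁ le_rfl zero_le_one hx
  · filter_upwards [eventually_ge_atTop 0] with x hx using wright_one_le_exp hν₀ hν₁ hx

theorem hasDerivAt_wright_one_neg {ν : ℝ} (hν₀ : 0 < ν) (hν₁ : ν < 1) (x : ℝ) :
    HasDerivAt (fun y => wright (-ν) 1 (-y)) (-mainardiM ν x) x := by
  have hsum : ∀ y : ℝ, Summable fun j : ℕ => y ^ j / (j.factorial * Real.Gamma (-ν * j + 1)) := by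
    simpa using fun y => summable_wright_term hν₀.le hν₁ le_rfl zero_le_one y
  have h := hasDerivAt_tsum_of_isPreconnected (t := Metric.ball (0 : ℝ) (|x| + 1)) (y₀ := x)
    (g := fun (j : ℕ) y =>
      (-y) ^ (j + 1) / ((j + 1).factorial * Real.Gamma (-ν * (j + 1 : ℕ) + 1)))
    (g' := fun (j : ℕ) y => -((-y) ^ j / (j.factorial * Real.Gamma (-ν * j + (1 - ν)))))
    (summable_wright_majorant hν₀.le hν₁ (show 0 ≤ |x| + 1 by positivity)) Metric.isOpen_ball
    (convex_ball _ _).isPreconnected (fun j y _ => ?_) (fun j y hy => ?_) (by simp)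
    ((summable_nat_add_iff 1).2 (hsum (-x))) (show x ∈ Metric.ball (0 : ℝ) (|x| + 1) by simp)
  · rw [tsum_neg] at h
    have heq : (fun y => wright (-ν) 1 (-y)) = fun y => (1 : ℝ) +
        ∑' j : ℕ, (-y) ^ (j + 1) / ((j + 1).factorial * Real.Gamma (-ν * (j + 1 : ℕ) + 1)) := by
      funext y
      rw [wright, (hsum (-y)).tsum_eq_zero_add]
      simp
    rw [heq]
    exact h.const_add 1
  · have hd := (((hasDerivAt_id y).neg).pow (j + 1)).div_const
      ((j + 1).factorial * Real.Gamma (-ν * (j + 1 : ℕ) + 1))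
    convert! hd using 1
    rw [show -ν * ((j + 1 : ℕ) : ℝ) + 1 = -ν * j + (1 - ν) by push_cast; ring, Nat.factorial_succ]
    have : (j : ℝ) + 1 ≠ 0 := by positivity
    push_cast
    simp only [id, Pi.neg_apply, mul_neg, mul_one, neg_div]
    rw [mul_assoc ((j : ℝ) + 1), mul_div_mul_left _ _ this]
  · rw [norm_neg]
    refine norm_wright_term_le hν₀.le hν₁.le hν₀.le hν₁.le ?_ j
    rw [abs_neg]
    simpa using (mem_ball_zero_iff.1 hy).le

theorem mainardiM_nonneg_probability_density (ν : ℝ) (hν0 : 0 < ν) (hν1 : ν < 1) :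
    (∀ x : ℝ, 0 ≤ x → 0 ≤ mainardiM ν x) ∧
    ∫ x in Set.Ioi (0 : ℝ), mainardiM ν x = 1 := by
  have hnonneg : ∀ x : ℝ, 0 ≤ x → 0 ≤ mainardiM ν x := fun x hx =>
    wright_nonneg hν0 hν1 hν0.le hν1.le hx
  refine ⟨hnonneg, ?_⟩
  have hzero : wright (-ν) 1 (-0) = 1 := by
    rw [wright, tsum_eq_single 0 fun j hj => by simp [hj]]
    simp
  have h := MeasureTheory.integral_Ioi_of_hasDerivAt_of_nonneg' (a := 0)
    (g := fun y => -wright (-ν) 1 (-y)) (g' := mainardiM ν) (l := -0)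
    (fun x _ => by simpa using! (hasDerivAt_wright_one_neg hν0 hν1 x).neg)
    (fun x hx => hnonneg x (le_of_lt hx)) (tendsto_wright_one_neg_atTop hν0 hν1).neg
  rw [h, hzero]
  norm_num
end

section
/- Let 0 < ν < 1. Then M_ν(x/ν) / ( a(ν) · x^{(ν - 1/2)/(1-ν)} · exp(-b(ν)·x^{1/(1-ν)}) ) → 1 as x → +∞, where a(ν) = 1/√(2π(1-ν)) > 0 and b(ν) = (1-ν)/ν > 0. -/
open scoped Real

open MeasureTheory Filter Topology

theorem integrable_exp_mul_sub_mul_exp {s B : ℝ} (hs : 0 < s) (hB : 0 < B) :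
    Integrable fun v : ℝ => Real.exp (s * v - B * Real.exp v) := by
  have h := integrableOn_rpow_mul_exp_neg_mul_rpow (p := 1) (s := s - 1) (b := B)
    (by linarith) one_pos hB
  rw [← Real.range_exp, ← Set.image_univ, integrableOn_image_iff_integrableOn_abs_deriv_smul
    MeasurableSet.univ (fun x _ => (Real.hasDerivAt_exp x).hasDerivWithinAt)
    Real.exp_injective.injOn, integrableOn_univ] at h
  refine h.congr (ae_of_all _ fun v => ?_)
  simp only [smul_eq_mul, Real.abs_exp, Real.rpow_one, ← Real.exp_mul, ← Real.exp_add]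
  congr 1
  ring

theorem integral_exp_mul_sub_mul_exp {s B : ℝ} (hs : 0 < s) (hB : 0 < B) :
    ∫ v : ℝ, Real.exp (s * v - B * Real.exp v) = (1 / B) ^ s * Real.Gamma s := by
  rw [← Real.integral_rpow_mul_exp_neg_mul_Ioi hs hB, ← Real.range_exp, ← Set.image_univ,
    integral_image_eq_integral_abs_deriv_smul
    MeasurableSet.univ (fun x _ => (Real.hasDerivAt_exp x).hasDerivWithinAt)
    Real.exp_injective.injOn, setIntegral_univ]
  congr 1 with v
  simp only [smul_eq_mul, Real.abs_exp, ← Real.exp_mul, ← Real.exp_add]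
  congr 1
  ring

theorem tendsto_exp_mul_sub_mul_exp_atTop (s : ℝ) {B : ℝ} (hB : 0 < B) :
    Tendsto (fun v : ℝ => Real.exp (s * v - B * Real.exp v)) atTop (𝓝 0) := by
  refine ((tendsto_rpow_mul_exp_neg_mul_atTop_nhds_zero s B hB).comp
    Real.tendsto_exp_atTop).congr fun v => ?_
  simp only [Function.comp_apply, ← Real.exp_mul, ← Real.exp_add]
  congr 1
  ring

theorem tendsto_exp_mul_sub_mul_exp_atBot {s B : ℝ} (hs : 0 < s) (hB : 0 < B) :
    Tendsto (fun v : ℝ => Real.exp (s * v - B * Real.exp v)) atBot (𝓝 0) := by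
  refine squeeze_zero (fun v => (Real.exp_pos _).le) (g := fun v => Real.exp (s * v))
    (fun v => Real.exp_le_exp.2 ?_)
    (Real.tendsto_exp_atBot.comp (tendsto_id.const_mul_atBot hs))
  have := mul_pos hB (Real.exp_pos v)
  linarith

theorem exists_mul_exp_mul_le {ν : ℝ} (hν0 : 0 < ν) (hν1 : ν < 1) {A B : ℝ} (hA : 0 ≤ A)
    (hB : 0 < B) : ∃ C, ∀ v : ℝ, A * Real.exp (ν * v) ≤ C + B * Real.exp v := by
  have h : Tendsto (fun v : ℝ => A * Real.exp ((ν - 1) * v)) atTop (𝓝 (A * 0)) :=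
    (Real.tendsto_exp_atBot.comp (tendsto_id.const_mul_atTop_of_neg (by linarith))).const_mul A
  rw [mul_zero] at h
  obtain ⟨v₀, hv₀⟩ := eventually_atTop.1 (h.eventually_le_const hB)
  refine ⟨A * Real.exp (ν * v₀), fun v => ?_⟩
  rcases le_total v v₀ with hv | hv
  · have : Real.exp (ν * v) ≤ Real.exp (ν * v₀) := by gcongr
    nlinarith [Real.exp_pos v]
  · have h1 := mul_le_mul_of_nonneg_right (hv₀ v hv) (Real.exp_pos v).le
    rw [mul_assoc, ← Real.exp_add, show (ν - 1) * v + v = ν * v by ring] at h1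
    have := mul_nonneg hA (Real.exp_pos (ν * v₀)).le
    linarith

theorem integral_horizontal_eq_of_bound {G : ℂ → ℂ} (hG : Differentiable ℂ G) {α β : ℝ}
    (hαβ : α ≤ β) {H : ℝ → ℝ} (hH : Integrable H) (htop : Tendsto H atTop (𝓝 0))
    (hbot : Tendsto H atBot (𝓝 0))
    (hb : ∀ v y : ℝ, α ≤ y → y ≤ β → ‖G (v + y * Complex.I)‖ ≤ H v) :
    ∫ v : ℝ, G (v + α * Complex.I) = ∫ v : ℝ, G (v + β * Complex.I) := by
  have hc := hG.continuous
  have hint : ∀ y, α ≤ y → y ≤ β → Integrable fun v : ℝ => G (v + y * Complex.I) :=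
    fun y h1 h2 => hH.mono' (Continuous.aestronglyMeasurable (by fun_prop))
      (ae_of_all _ fun v => hb v y h1 h2)
  have hlim : ∀ y, α ≤ y → y ≤ β → Tendsto (fun R : ℝ => ∫ v in (-R)..R, G (v + y * Complex.I))
      atTop (𝓝 (∫ v : ℝ, G (v + y * Complex.I))) := fun y h1 h2 =>
    intervalIntegral_tendsto_integral (hint y h1 h2) tendsto_neg_atTop_atBot tendsto_id
  have hside : ∀ φ : ℝ → ℝ, Tendsto (fun R => H (φ R)) atTop (𝓝 0) →
      Tendsto (fun R : ℝ => Complex.I • ∫ y in α..β, G ((φ R : ℝ) + y * Complex.I)) atTop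
        (𝓝 0) := by
    intro φ hφ
    have h2 : Tendsto (fun R => H (φ R) * |β - α|) atTop (𝓝 0) := by
      simpa using hφ.mul_const |β - α|
    refine squeeze_zero_norm (fun R => ?_) h2
    rw [norm_smul, Complex.norm_I, one_mul]
    refine intervalIntegral.norm_integral_le_of_norm_le_const fun y hy => ?_
    rw [Set.uIoc_of_le hαβ] at hy
    exact hb _ _ hy.1.le hy.2
  have hrect : ∀ R : ℝ, _ := fun R => Complex.integral_boundary_rect_eq_zero_of_differentiableOn G
    ⟨-R, α⟩ ⟨R, β⟩ hG.differentiableOn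
  have := ((hlim α le_rfl hαβ).sub (hlim β hαβ le_rfl)).add (hside _ (htop.comp tendsto_id))
    |>.sub (hside _ (hbot.comp tendsto_neg_atTop_atBot))
  have h0 := tendsto_nhds_unique this (tendsto_const_nhds.congr fun R => (hrect R).symm)
  simp only [add_zero, sub_zero] at h0
  exact sub_eq_zero.1 h0

theorem integral_horizontal_Iic_sub {G : ℂ → ℂ} (hG : Differentiable ℂ G) {α β : ℝ}
    (hαβ : α ≤ β) {H : ℝ → ℝ} (hH : IntegrableOn H (Set.Iic 0))
    (hbot : Tendsto H atBot (𝓝 0))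
    (hb : ∀ v y : ℝ, v ≤ 0 → α ≤ y → y ≤ β → ‖G (v + y * Complex.I)‖ ≤ H v) :
    (∫ v : ℝ in Set.Iic 0, G (v + β * Complex.I)) - ∫ v : ℝ in Set.Iic 0, G (v + α * Complex.I) =
      Complex.I * ∫ y in α..β, G (y * Complex.I) := by
  have hc := hG.continuous
  have hint : ∀ y, α ≤ y → y ≤ β →
      IntegrableOn (fun v : ℝ => G (v + y * Complex.I)) (Set.Iic 0) :=
    fun y h1 h2 => Integrable.mono' hH (Continuous.aestronglyMeasurable (by fun_prop))
      ((ae_restrict_iff' measurableSet_Iic).2 (ae_of_all _ fun v hv => hb v y hv h1 h2))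
  have hlim : ∀ y, α ≤ y → y ≤ β → Tendsto (fun R : ℝ => ∫ v in (-R)..0, G (v + y * Complex.I))
      atTop (𝓝 (∫ v : ℝ in Set.Iic 0, G (v + y * Complex.I))) := fun y h1 h2 =>
    intervalIntegral_tendsto_integral_Iic _ (hint y h1 h2) tendsto_neg_atTop_atBot
  have hside : Tendsto (fun R : ℝ => Complex.I • ∫ y in α..β, G ((-R : ℝ) + y * Complex.I)) atTop
        (𝓝 0) := by
    have h2 : Tendsto (fun R => H (-R) * |β - α|) atTop (𝓝 0) := by
      simpa using (hbot.comp tendsto_neg_atTop_atBot).mul_const |β - α|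
    refine squeeze_zero_norm' ((eventually_ge_atTop 0).mono fun R hR => ?_) h2
    rw [norm_smul, Complex.norm_I, one_mul]
    refine intervalIntegral.norm_integral_le_of_norm_le_const fun y hy => ?_
    rw [Set.uIoc_of_le hαβ] at hy
    exact hb _ _ (by linarith) hy.1.le hy.2
  have hrect : ∀ R : ℝ, _ := fun R => Complex.integral_boundary_rect_eq_zero_of_differentiableOn G
    ⟨-R, α⟩ ⟨0, β⟩ hG.differentiableOn
  have := ((hlim α le_rfl hαβ).sub (hlim β hαβ le_rfl)).add_const
    (Complex.I • ∫ y in α..β, G ((0 : ℝ) + y * Complex.I)) |>.sub hside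
  have h0 := tendsto_nhds_unique this (tendsto_const_nhds.congr fun R => (hrect R).symm)
  simp only [sub_zero, Complex.ofReal_zero, zero_add, smul_eq_mul] at h0
  linear_combination -h0

/-- The integrand `e^{N(e^w - e^{νw}/ν + (1-ν)/ν) + νw}` obtained from the Hankel representation of
`M_ν(N^{1-ν}/ν)` by the substitution `σ = N e^w`, normalised at the saddle point `w = 0`. -/
noncomputable def mainardiKernel (ν N : ℝ) (w : ℂ) : ℂ :=
  Complex.exp (N * (Complex.exp w - Complex.exp (ν * w) / ν + (1 - ν) / ν) + ν * w)

theorem differentiable_mainardiKernel (ν N : ℝ) : Differentiable ℂ (mainardiKernel ν N) := by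
  unfold mainardiKernel
  fun_prop

theorem norm_mainardiKernel (ν N v y : ℝ) :
    ‖mainardiKernel ν N (v + y * Complex.I)‖ =
      Real.exp (N * (Real.exp v * Real.cos y - Real.exp (ν * v) * Real.cos (ν * y) / ν +
        (1 - ν) / ν) + ν * v) := by
  rw [mainardiKernel, Complex.norm_exp]
  congr 1
  have h1 : (Complex.exp (v + y * Complex.I)).re = Real.exp v * Real.cos y := by
    simp [Complex.exp_re]
  have h2 : (Complex.exp (ν * (v + y * Complex.I))).re = Real.exp (ν * v) * Real.cos (ν * y) := by
    simp [Complex.exp_re]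
  have h3 : ((1 - ν) / ν : ℂ) = (((1 - ν) / ν : ℝ) : ℂ) := by push_cast; rfl
  rw [Complex.add_re, Complex.re_ofReal_mul, Complex.re_ofReal_mul, h3, Complex.add_re,
    Complex.sub_re, Complex.div_ofReal_re, h1, h2, Complex.ofReal_re]
  simp

theorem mainardiKernel_ofReal_im (ν N v : ℝ) : (mainardiKernel ν N v).im = 0 := by
  have : mainardiKernel ν N v =
      (Real.exp (N * (Real.exp v - Real.exp (ν * v) / ν + (1 - ν) / ν) + ν * v) : ℝ) := by
    simp [mainardiKernel]
  rw [this, Complex.ofReal_im]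

theorem inv_Gamma_one_sub {s : ℝ} (hs : 0 < s) :
    (Real.Gamma (1 - s))⁻¹ = Real.Gamma s * Real.sin (π * s) / π := by
  have h := Real.Gamma_mul_Gamma_one_sub s
  have hG := (Real.Gamma_pos_of_pos hs).ne'
  by_cases hsin : Real.sin (π * s) = 0
  · rw [hsin, div_zero] at h
    simp [(mul_eq_zero.1 h).resolve_left hG, hsin]
  · have : Real.Gamma (1 - s) = π / Real.sin (π * s) / Real.Gamma s := by
      rw [← h]; field_simp
    rw [this]
    field_simp

theorem hasSum_mainardiKernel {ν N : ℝ} (hν0 : 0 < ν) (hν1 : ν < 1) (hN : 0 < N) :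
    HasSum (fun n : ℕ => ((-(N / ν)) ^ n / n.factorial : ℝ) *
        Complex.exp ((ν * (n + 1) : ℝ) * (π * Complex.I)) *
        ((1 / N) ^ (ν * (n + 1)) * Real.Gamma (ν * (n + 1)) : ℝ))
      (Real.exp (-((1 - ν) / ν) * N) * ∫ v : ℝ, mainardiKernel ν N (v + π * Complex.I)) := by
  have hA : 0 < N / ν := div_pos hN hν0
  have key := hasSum_integral_of_dominated_convergence (μ := (volume : Measure ℝ))
    (F := fun (n : ℕ) (v : ℝ) => ((-(N / ν)) ^ n / n.factorial : ℝ) *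
        Complex.exp ((ν * (n + 1) : ℝ) * (π * Complex.I)) *
        (Real.exp ((ν * (n + 1)) * v - N * Real.exp v) : ℝ))
    (f := fun v : ℝ => Real.exp (-((1 - ν) / ν) * N) * mainardiKernel ν N (v + π * Complex.I))
    (fun n v => Real.exp (ν * v - N * Real.exp v) *
      ((N / ν * Real.exp (ν * v)) ^ n / n.factorial)) ?_ ?_ ?_ ?_ ?_
  · rw [integral_const_mul] at key
    refine key.congr_fun fun n => ?_
    rw [integral_const_mul, integral_complex_ofReal, integral_exp_mul_sub_mul_exp (by positivity) hN]
  · intro n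
    exact Continuous.aestronglyMeasurable (by fun_prop)
  · refine fun n => ae_of_all _ fun v => le_of_eq ?_
    have h1 : ‖Complex.exp ((ν * (n + 1) : ℝ) * (π * Complex.I))‖ = 1 := by
      rw [← mul_assoc, ← Complex.ofReal_mul, Complex.norm_exp_ofReal_mul_I]
    rw [norm_mul, norm_mul, h1, Complex.norm_real, Complex.norm_real, Real.norm_eq_abs,
      Real.norm_eq_abs, Real.abs_exp, abs_div, abs_pow, abs_neg, abs_of_pos hA, Nat.abs_cast,
      mul_pow, ← Real.exp_nat_mul, show ν * (n + 1) * v - N * Real.exp v =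
        (ν * v - N * Real.exp v) + n * (ν * v) by ring, Real.exp_add]
    ring
  · exact ae_of_all _ fun v => (Real.summable_pow_div_factorial _).mul_left _
  · obtain ⟨C, hC⟩ := exists_mul_exp_mul_le hν0 hν1 hA.le (half_pos hN)
    have hs : ∀ v : ℝ, ∑' n : ℕ, Real.exp (ν * v - N * Real.exp v) *
        ((N / ν * Real.exp (ν * v)) ^ n / n.factorial) =
        Real.exp (ν * v - N * Real.exp v + N / ν * Real.exp (ν * v)) := fun v => by
      rw [tsum_mul_left, Real.exp_add, Real.exp_eq_exp_ℝ, NormedSpace.exp_eq_tsum_div]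
    simp_rw [hs]
    refine ((integrable_exp_mul_sub_mul_exp hν0 (half_pos hN)).const_mul (Real.exp C)).mono'
      (Continuous.aestronglyMeasurable (by fun_prop)) (ae_of_all _ fun v => ?_)
    rw [Real.norm_eq_abs, Real.abs_exp, ← Real.exp_add]
    refine Real.exp_le_exp.2 ?_
    linarith [hC v]
  · refine ae_of_all _ fun v => ?_
    have h := (NormedSpace.expSeries_div_hasSum_exp
      (-(N / ν) * Complex.exp (ν * (v + π * Complex.I)))).mul_left
      (Complex.exp (ν * (v + π * Complex.I) - N * Complex.exp v))
    rw [← Complex.exp_eq_exp_ℂ, ← Complex.exp_add] at h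
    convert! h using 1
    · ext n
      rw [mul_pow, ← Complex.exp_nat_mul]
      push_cast
      rw [show Complex.exp (ν * (v + π * Complex.I) - N * Complex.exp v) *
        ((-(N / ν)) ^ n * Complex.exp (n * (ν * (v + π * Complex.I))) / n.factorial) =
        (-(N / ν)) ^ n / n.factorial * (Complex.exp (ν * (v + π * Complex.I) - N * Complex.exp v) *
         Complex.exp (n * (ν * (v + π * Complex.I)))) by ring, mul_assoc, ← Complex.exp_add,
         ← Complex.exp_add]
      congr 2
      ring
    · rw [mainardiKernel, Complex.ofReal_exp, ← Complex.exp_add, Complex.exp_add v,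
        Complex.exp_pi_mul_I]
      congr 1
      push_cast
      ring

theorem mainardiM_eq_integral {ν N : ℝ} (hν0 : 0 < ν) (hν1 : ν < 1) (hN : 0 < N) :
    mainardiM ν (N ^ (1 - ν) / ν) = N ^ ν * Real.exp (-((1 - ν) / ν) * N) / π *
      (∫ v : ℝ, mainardiKernel ν N (v + π * Complex.I)).im := by
  have h := (Complex.hasSum_im (hasSum_mainardiKernel hν0 hν1 hN)).mul_left (N ^ ν / π)
  rw [Complex.im_ofReal_mul] at h
  rw [mainardiM, wright, mul_div_right_comm, mul_assoc, ← h.tsum_eq]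
  refine tsum_congr fun n => ?_
  have hs : 0 < ν * (n + 1) := by positivity
  have hNn : (-(N ^ (1 - ν) / ν)) ^ n = (-(N / ν)) ^ n * (N ^ ν * (1 / N) ^ (ν * (n + 1))) := by
    rw [neg_pow, neg_pow (N / ν), div_pow, div_pow, ← Real.rpow_natCast (N ^ (1 - ν)),
      ← Real.rpow_mul hN.le, one_div, Real.inv_rpow hN.le, ← Real.rpow_neg hN.le,
      ← Real.rpow_add hN, show (1 - ν) * n = n + (ν + -(ν * (n + 1))) by ring,
      Real.rpow_add hN n, Real.rpow_natCast]
    ring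
  have him : (Complex.exp ((ν * (n + 1) : ℝ) * (π * Complex.I))).im =
      Real.sin (π * (ν * (n + 1))) := by
    rw [← mul_assoc, ← Complex.ofReal_mul, Complex.exp_ofReal_mul_I_im, mul_comm]
  rw [Complex.im_mul_ofReal, Complex.im_ofReal_mul, him, hNn,
    show -ν * (n : ℝ) + (1 - ν) = 1 - ν * (n + 1) by ring, div_eq_mul_inv, mul_inv,
    inv_Gamma_one_sub hs]
  ring

theorem exists_norm_mainardiKernel_le {ν N α : ℝ} (hν0 : 0 < ν) (hν1 : ν < 1) (hN : 0 < N)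
    (hα : π / 2 < α) :
    ∃ D, ∃ B > 0, ∀ v y : ℝ, α ≤ y → y ≤ π →
      ‖mainardiKernel ν N (v + y * Complex.I)‖ ≤ D * Real.exp (ν * v - B * Real.exp v) := by
  rcases lt_or_ge π α with hαπ | hαπ
  · exact ⟨0, 1, one_pos, fun v y h1 h2 => absurd (h1.trans h2) hαπ.not_ge⟩
  have hc : Real.cos α < 0 := Real.cos_neg_of_pi_div_two_lt_of_lt hα (by linarith)
  have hB : 0 < N * -Real.cos α / 2 := half_pos (mul_pos hN (neg_pos.2 hc))
  obtain ⟨C, hC⟩ := exists_mul_exp_mul_le hν0 hν1 (div_pos hN hν0).le hB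
  refine ⟨Real.exp (N * ((1 - ν) / ν) + C), _, hB, fun v y h1 h2 => ?_⟩
  rw [norm_mainardiKernel, ← Real.exp_add]
  refine Real.exp_le_exp.2 ?_
  have hcos : Real.cos y ≤ Real.cos α :=
    Real.cos_le_cos_of_nonneg_of_le_pi (by linarith [Real.pi_pos]) h2 h1
  have e1 : N * Real.exp v * Real.cos y ≤ N * Real.exp v * Real.cos α := by gcongr
  have e2 : -(N / ν * Real.exp (ν * v) * Real.cos (ν * y)) ≤ N / ν * Real.exp (ν * v) := by
    have : 0 < N / ν * Real.exp (ν * v) := by positivity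
    nlinarith [Real.neg_one_le_cos (ν * y)]
  have e3 : N * (Real.exp (ν * v) * Real.cos (ν * y) / ν) =
      N / ν * Real.exp (ν * v) * Real.cos (ν * y) := by ring
  linear_combination e1 + e2 + hC v - e3

theorem im_integral_mainardiKernel {ν N α : ℝ} (hν0 : 0 < ν) (hν1 : ν < 1) (hN : 0 < N)
    (hα : π / 2 < α) (hαπ : α ≤ π) :
    (∫ v : ℝ, mainardiKernel ν N (v + π * Complex.I)).im =
      (∫ y in (0 : ℝ)..α, mainardiKernel ν N (y * Complex.I)).re +
        (∫ v : ℝ in Set.Ioi 0, mainardiKernel ν N (v + α * Complex.I)).im := by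
  have hd := differentiable_mainardiKernel ν N
  have hc := hd.continuous
  obtain ⟨D, B, hB, hb⟩ := exists_norm_mainardiKernel_le hν0 hν1 hN hα
  have hI := (integrable_exp_mul_sub_mul_exp hν0 hB).const_mul D
  rw [← integral_horizontal_eq_of_bound hd hαπ hI
    (by simpa using (tendsto_exp_mul_sub_mul_exp_atTop ν hB).const_mul D)
    (by simpa using (tendsto_exp_mul_sub_mul_exp_atBot hν0 hB).const_mul D) hb,
    ← intervalIntegral.integral_Iic_add_Ioi (b := (0 : ℝ)), Complex.add_im]
  · congr 1
    have h := integral_horizontal_Iic_sub hd (α := 0) (β := α) (by linarith [Real.pi_pos])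
      (H := fun v => Real.exp (N * (1 + 1 / ν + (1 - ν) / ν)) * Real.exp (ν * v))
      ((integrableOn_exp_mul_Iic hν0 0).const_mul _)
      (by
        rw [← mul_zero (Real.exp (N * (1 + 1 / ν + (1 - ν) / ν)))]
        exact (Real.tendsto_exp_atBot.comp (tendsto_id.const_mul_atBot hν0)).const_mul _) ?_
    · have h0 : (∫ v : ℝ in Set.Iic 0, mainardiKernel ν N (v + (0 : ℝ) * Complex.I)).im = 0 := by
        have : ∀ v : ℝ, mainardiKernel ν N (v + (0 : ℝ) * Complex.I) =
            ((mainardiKernel ν N v).re : ℂ) := fun v => by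
          rw [Complex.ofReal_zero, zero_mul, add_zero]
          exact Complex.ext rfl (mainardiKernel_ofReal_im ν N v)
        simp_rw [this]
        rw [integral_complex_ofReal, Complex.ofReal_im]
      have h1 := congrArg Complex.im h
      rw [Complex.sub_im, h0, sub_zero, Complex.I_mul_im] at h1
      exact h1
    · intro v y hv _ _
      rw [norm_mainardiKernel, ← Real.exp_add]
      refine Real.exp_le_exp.2 ?_
      have e1 : Real.exp v * Real.cos y ≤ 1 := by
        have := Real.exp_le_one_iff.2 hv
        nlinarith [Real.cos_le_one y, Real.exp_pos v]
      have e2 : -(Real.exp (ν * v) * Real.cos (ν * y)) ≤ 1 := by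
        have := Real.exp_le_one_iff.2 (mul_nonpos_of_nonneg_of_nonpos hν0.le hv)
        nlinarith [Real.neg_one_le_cos (ν * y), Real.exp_pos (ν * v)]
      have e3 : -(Real.exp (ν * v) * Real.cos (ν * y)) / ν ≤ 1 / ν := by gcongr
      gcongr
      linear_combination e1 + e3
  all_goals
    exact (hI.mono' (Continuous.aestronglyMeasurable (by fun_prop))
      (ae_of_all _ fun v => hb v α le_rfl hαπ)).integrableOn

theorem exists_cos_sub_cos_mul_le {ν α : ℝ} (hν0 : 0 < ν) (hν1 : ν < 1)
    (hα : α * (1 + ν) < π) : ∃ k > 0, ∀ θ, 0 ≤ θ → θ ≤ α →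
      Real.cos θ - Real.cos (ν * θ) / ν + (1 - ν) / ν ≤ -(k * θ ^ 2) := by
  rcases lt_or_ge α 0 with hα0 | hα0
  · exact ⟨1, one_pos, fun θ h1 h2 => by linarith⟩
  have hm : 0 < Real.cos (α * (1 + ν) / 2) :=
    Real.cos_pos_of_mem_Ioo ⟨by nlinarith [Real.pi_pos], by linarith⟩
  set m := Real.cos (α * (1 + ν) / 2)
  have hk : 0 < m * (1 - ν) / π := div_pos (mul_pos hm (by linarith)) Real.pi_pos
  set k := m * (1 - ν) / π with hk_def
  refine ⟨k, hk, fun θ h1 h2 => ?_⟩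
  have hder : ∀ t, HasDerivAt (fun t => Real.cos t - Real.cos (ν * t) / ν + (1 - ν) / ν + k * t ^ 2)
      (-Real.sin t + Real.sin (ν * t) + 2 * k * t) t := fun t => by
    have h3 : HasDerivAt (fun t => Real.cos (ν * t)) (-Real.sin (ν * t) * ν) t := by
      simpa using ((hasDerivAt_id t).const_mul ν).cos
    convert! (((Real.hasDerivAt_cos t).sub (h3.div_const ν)).add_const ((1 - ν) / ν)).add
      ((hasDerivAt_pow 2 t).const_mul k) using 1
    field_simp
    push_cast
    ring
  have hanti := antitoneOn_of_deriv_nonpos (convex_Icc 0 α)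
    (fun t _ => (hder t).continuousAt.continuousWithinAt)
    (fun t _ => (hder t).differentiableAt.differentiableWithinAt) (fun t ht => by
      rw [interior_Icc] at ht
      rw [(hder t).deriv]
      have e1 := Real.sin_sub_sin t (ν * t)
      have e2 : 2 / π * ((t - ν * t) / 2) ≤ Real.sin ((t - ν * t) / 2) :=
        Real.mul_le_sin (by nlinarith [ht.1]) (by nlinarith [ht.1, ht.2])
      have e3 : m ≤ Real.cos ((t + ν * t) / 2) :=
        Real.cos_le_cos_of_nonneg_of_le_pi (by nlinarith [ht.1])
          (by linarith [Real.pi_pos])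
          (by nlinarith [ht.1, ht.2])
      have e4 : 0 ≤ 2 / π * ((t - ν * t) / 2) :=
        mul_nonneg (by positivity) (by nlinarith [ht.1])
      have e5 := mul_le_mul e2 e3 hm.le (e4.trans e2)
      have e6 : 2 * k * t = 2 * (2 / π * ((t - ν * t) / 2) * m) := by
        rw [hk_def]; ring
      linear_combination e6 + 2 * e5 - e1)
  have := hanti (Set.left_mem_Icc.2 hα0) ⟨h1, h2⟩ h1
  have h0 : (1 : ℝ) - 1 / ν + (1 - ν) / ν = 0 := by field_simp; ring
  simp only [mul_zero, Real.cos_zero] at this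
  nlinarith

theorem exists_norm_integral_Ioi_mainardiKernel_le {ν α : ℝ} (hν0 : 0 < ν) (hν1 : ν < 1)
    (hα : π / 2 < α) (hα' : α * (1 + ν) < π) :
    ∃ δ > 0, ∃ D, ∀ N ≥ 1,
      ‖∫ v : ℝ in Set.Ioi 0, mainardiKernel ν N (v + α * Complex.I)‖ ≤
        Real.exp (-δ * N) * D := by
  have hα0 : 0 < α := by linarith [Real.pi_pos]
  have hc : 0 < -Real.cos α :=
    neg_pos.2 (Real.cos_neg_of_pi_div_two_lt_of_lt hα (by nlinarith))
  have hc' : 0 ≤ Real.cos (ν * α) / ν := div_nonneg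
    (Real.cos_nonneg_of_mem_Icc ⟨by nlinarith [Real.pi_pos], by nlinarith⟩) hν0.le
  obtain ⟨k, hk, hle⟩ := exists_cos_sub_cos_mul_le hν0 hν1 hα'
  have hI := ((integrable_exp_mul_sub_mul_exp hν0 hc).const_mul
    (Real.exp (-Real.cos α))).integrableOn (s := Set.Ioi 0)
  refine ⟨k * α ^ 2, by positivity, ∫ v : ℝ in Set.Ioi 0,
    Real.exp (-Real.cos α) * Real.exp (ν * v - -Real.cos α * Real.exp v), fun N hN => ?_⟩
  rw [← integral_const_mul]
  refine norm_integral_le_of_norm_le (hI.const_mul _)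
    ((ae_restrict_iff' measurableSet_Ioi).2 (ae_of_all _ fun v hv => ?_))
  rw [norm_mainardiKernel, ← Real.exp_add, ← Real.exp_add]
  refine Real.exp_le_exp.2 ?_
  have hv1 : 1 ≤ Real.exp v := Real.one_le_exp (le_of_lt hv)
  have hv2 : 1 ≤ Real.exp (ν * v) := Real.one_le_exp (mul_nonneg hν0.le (le_of_lt hv))
  have e1 : Real.exp v * Real.cos α - Real.exp (ν * v) * Real.cos (ν * α) / ν + (1 - ν) / ν ≤
      -(k * α ^ 2) - -Real.cos α * (Real.exp v - 1) := by
    have := hle α hα0.le le_rfl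
    have := mul_le_mul_of_nonneg_right hv2 hc'
    rw [mul_div_assoc]
    linarith
  have e2 := mul_le_mul_of_nonneg_left e1 (by linarith : 0 ≤ N)
  have e3 : 0 ≤ (N - 1) * (-Real.cos α * (Real.exp v - 1)) :=
    mul_nonneg (by linarith) (mul_nonneg hc.le (by linarith))
  linear_combination e2 + e3

theorem tendsto_exp_sub_one_sub_div_sq :
    Tendsto (fun w : ℂ => (Complex.exp w - 1 - w) / w ^ 2) (𝓝[≠] 0) (𝓝 (1 / 2)) := by
  have h := (Complex.exp_sub_sum_range_succ_isLittleO_pow 2).mono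
    (nhdsWithin_le_nhds (s := {0}ᶜ))
  have h1 := h.tendsto_div_nhds_zero.add_const (1 / 2)
  rw [zero_add] at h1
  refine h1.congr' (eventually_mem_nhdsWithin.mono fun w hw => ?_)
  have : w ≠ 0 := hw
  simp only [Finset.sum_range_succ, Finset.sum_range_zero]
  simp
  field_simp
  ring

theorem tendsto_mainardiKernel_div_sqrt {ν u : ℝ} (hν0 : 0 < ν) (hu : 0 < u) :
    Tendsto (fun N : ℝ => mainardiKernel ν N ((u / √N : ℝ) * Complex.I)) atTop
      (𝓝 (Real.exp (-((1 - ν) / 2) * u ^ 2) : ℝ)) := by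
  set w : ℝ → ℂ := fun N => (u / √N : ℝ) * Complex.I with hw
  have hw0 : Tendsto w atTop (𝓝 0) := by
    have : Tendsto (fun N : ℝ => u / √N) atTop (𝓝 0) :=
      tendsto_const_nhds.div_atTop Real.tendsto_sqrt_atTop
    simpa [hw] using (Complex.continuous_ofReal.tendsto 0 |>.comp this).mul_const Complex.I
  have hne : ∀ᶠ N in atTop, w N ≠ 0 := (eventually_gt_atTop 0).mono fun N hN => by
    have : u / √N ≠ 0 := by positivity
    simpa [hw] using this
  have hwν : ∀ᶠ N in atTop, (ν : ℂ) * w N ≠ 0 := hne.mono fun N h =>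
    mul_ne_zero (Complex.ofReal_ne_zero.2 hν0.ne') h
  have hw0ν : Tendsto (fun N => (ν : ℂ) * w N) atTop (𝓝 0) := by simpa using hw0.const_mul (ν : ℂ)
  have h1 := tendsto_exp_sub_one_sub_div_sq.comp (tendsto_nhdsWithin_iff.2 ⟨hw0, hne⟩)
  have h2 := tendsto_exp_sub_one_sub_div_sq.comp (tendsto_nhdsWithin_iff.2 ⟨hw0ν, hwν⟩)
  have h3 := (((h1.sub (h2.const_mul (ν : ℂ))).const_mul (-(u : ℂ) ^ 2)).add hw0ν).cexp
  have hlim : Complex.exp (-(u : ℂ) ^ 2 * (1 / 2 - ν * (1 / 2)) + 0) =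
      (Real.exp (-((1 - ν) / 2) * u ^ 2) : ℝ) := by
    push_cast
    congr 1
    ring
  rw [hlim] at h3
  refine h3.congr' ?_
  filter_upwards [hne, eventually_gt_atTop 0] with N h hN
  have hsq : -(u : ℂ) ^ 2 = N * w N ^ 2 := by
    rw [hw]
    simp only [mul_pow, Complex.I_sq, ← Complex.ofReal_pow, div_pow, Real.sq_sqrt hN.le]
    push_cast
    have : (N : ℂ) ≠ 0 := Complex.ofReal_ne_zero.2 hN.ne'
    field_simp
  have hν : (ν : ℂ) ≠ 0 := Complex.ofReal_ne_zero.2 hν0.ne'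
  rw [show ((u / √N : ℝ) : ℂ) * Complex.I = w N from rfl, mainardiKernel, hsq]
  congr 1
  simp only [Function.comp_apply]
  field_simp
  ring

theorem tendsto_sqrt_mul_integral_mainardiKernel {ν α : ℝ} (hν0 : 0 < ν) (hν1 : ν < 1)
    (hα0 : 0 < α) (hα : α * (1 + ν) < π) :
    Tendsto (fun N : ℝ => (√N : ℂ) * ∫ y in (0 : ℝ)..α, mainardiKernel ν N (y * Complex.I)) atTop
      (𝓝 (√(π / ((1 - ν) / 2)) / 2 : ℝ)) := by
  obtain ⟨k, hk, hle⟩ := exists_cos_sub_cos_mul_le hν0 hν1 hα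
  have key := tendsto_integral_filter_of_dominated_convergence
    (μ := volume.restrict (Set.Ioi (0 : ℝ))) (l := atTop)
    (F := fun (N u : ℝ) => (Set.Ioc 0 (α * √N)).indicator
      (fun u : ℝ => mainardiKernel ν N ((u / √N : ℝ) * Complex.I)) u)
    (f := fun u : ℝ => ((Real.exp (-((1 - ν) / 2) * u ^ 2) : ℝ) : ℂ))
    (fun u => Real.exp (-k * u ^ 2)) ?_ ?_ ?_ ?_
  · rw [integral_complex_ofReal, integral_gaussian_Ioi] at key
    refine key.congr' ((eventually_gt_atTop 0).mono fun N hN => ?_)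
    have hs : √N ≠ 0 := (Real.sqrt_pos.2 hN).ne'
    have h := intervalIntegral.integral_comp_div (a := 0) (b := α * √N)
      (fun y : ℝ => mainardiKernel ν N (y * Complex.I)) hs
    rw [zero_div, mul_div_cancel_right₀ _ hs, Complex.real_smul] at h
    dsimp only
    rw [← h, intervalIntegral.integral_of_le (by positivity),
      integral_indicator measurableSet_Ioc, Measure.restrict_restrict measurableSet_Ioc,
      Set.inter_eq_left.2 Set.Ioc_subset_Ioi_self]
  · have hc : ∀ N, Continuous (mainardiKernel ν N) := fun N =>
      (differentiable_mainardiKernel ν N).continuous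
    exact Eventually.of_forall fun N => ((Continuous.aestronglyMeasurable
      (by have := hc N; fun_prop)).indicator measurableSet_Ioc)
  · refine (eventually_gt_atTop 0).mono fun N hN => ae_of_all _ fun u => ?_
    have hs := Real.sqrt_pos.2 hN
    by_cases hu : u ∈ Set.Ioc 0 (α * √N)
    · rw [Set.indicator_of_mem hu]
      have h := norm_mainardiKernel ν N 0 (u / √N)
      rw [Complex.ofReal_zero, zero_add] at h
      rw [h]
      refine Real.exp_le_exp.2 ?_
      have h2 := mul_le_mul_of_nonneg_left
        (hle (u / √N) (div_nonneg hu.1.le hs.le) ((div_le_iff₀ hs).2 hu.2)) hN.le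
      have h3 : N * -(k * (u / √N) ^ 2) = -k * u ^ 2 := by
        rw [div_pow, Real.sq_sqrt hN.le]
        field_simp
      simp only [mul_zero, Real.exp_zero, one_mul, add_zero]
      linarith
    · rw [Set.indicator_of_notMem hu, norm_zero]
      exact (Real.exp_pos _).le
  · exact (integrable_exp_neg_mul_sq hk).integrableOn
  · refine (ae_restrict_iff' measurableSet_Ioi).2 (ae_of_all _ fun u hu => ?_)
    refine (tendsto_mainardiKernel_div_sqrt hν0 hu).congr' ?_
    filter_upwards [(Real.tendsto_sqrt_atTop.const_mul_atTop hα0).eventually_ge_atTop u] with N hN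
    rw [Set.indicator_of_mem (show u ∈ Set.Ioc 0 (α * √N) from ⟨hu, hN⟩)]

theorem tendsto_sqrt_mul_im_integral_mainardiKernel {ν : ℝ} (hν0 : 0 < ν) (hν1 : ν < 1) :
    Tendsto (fun N : ℝ => √N * (∫ v : ℝ, mainardiKernel ν N (v + π * Complex.I)).im) atTop
      (𝓝 (√(π / ((1 - ν) / 2)) / 2)) := by
  obtain ⟨α, hα, hα'⟩ : ∃ α, π / 2 < α ∧ α < π / (1 + ν) :=
    exists_between (div_lt_div_of_pos_left Real.pi_pos (by linarith) (by linarith))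
  rw [lt_div_iff₀ (by linarith)] at hα'
  have hα0 : 0 < α := by linarith [Real.pi_pos]
  have hmain := (Complex.continuous_re.tendsto _).comp
    (tendsto_sqrt_mul_integral_mainardiKernel hν0 hν1 hα0 hα')
  obtain ⟨δ, hδ, D, hD⟩ := exists_norm_integral_Ioi_mainardiKernel_le hν0 hν1 hα hα'
  have htail : Tendsto (fun N : ℝ => √N *
      (∫ v : ℝ in Set.Ioi 0, mainardiKernel ν N (v + α * Complex.I)).im) atTop (𝓝 0) := by
    have h0 := (tendsto_rpow_mul_exp_neg_mul_atTop_nhds_zero (1 / 2) δ hδ).mul_const D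
    rw [zero_mul] at h0
    refine squeeze_zero_norm' ((eventually_ge_atTop 1).mono fun N hN => ?_) h0
    rw [norm_mul, Real.norm_of_nonneg (Real.sqrt_nonneg N), ← Real.sqrt_eq_rpow, mul_assoc]
    gcongr
    exact (Complex.abs_im_le_norm _).trans (hD N hN)
  have h := hmain.add htail
  rw [Complex.ofReal_re, add_zero] at h
  refine h.congr' ((eventually_gt_atTop 0).mono fun N hN => ?_)
  dsimp only
  rw [im_integral_mainardiKernel hν0 hν1 hN hα (by nlinarith), Function.comp_apply,
    Complex.re_ofReal_mul]
  ring

/-- Mainardi–Tomirotti saddle-point asymptotics of `M_ν(x/ν)` as `x → +∞`. -/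
theorem mainardiM_asymptotics (ν : ℝ) (hν0 : 0 < ν) (hν1 : ν < 1)
    (a b : ℝ) (ha : a = 1 / Real.sqrt (2 * π * (1 - ν))) (hb : b = (1 - ν) / ν) :
    Filter.Tendsto
      (fun x : ℝ => mainardiM ν (x / ν) /
        (a * x ^ ((ν - 1 / 2) / (1 - ν)) * Real.exp (-b * x ^ (1 / (1 - ν)))))
      Filter.atTop (nhds 1) := by
  have hν : 0 < 1 - ν := by linarith
  have ha0 : 0 < a := by rw [ha]; have := Real.pi_pos; positivity
  have hlim : √(π / ((1 - ν) / 2)) / 2 = π * a := by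
    rw [ha, show π / ((1 - ν) / 2) = (2 * π) ^ 2 / (2 * π * (1 - ν)) by
      have := Real.pi_pos; field_simp, Real.sqrt_div (by positivity),
      Real.sqrt_sq (by have := Real.pi_pos; positivity)]
    ring
  have h := ((tendsto_sqrt_mul_im_integral_mainardiKernel hν0 hν1).comp
    (tendsto_rpow_atTop (one_div_pos.2 hν))).div_const (π * a)
  rw [hlim, div_self (mul_pos Real.pi_pos ha0).ne'] at h
  refine h.congr' ((eventually_gt_atTop 0).mono fun x hx => ?_)
  have hN : 0 < x ^ (1 / (1 - ν)) := Real.rpow_pos_of_pos hx _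
  have hx1 : x = (x ^ (1 / (1 - ν))) ^ (1 - ν) := by
    rw [← Real.rpow_mul hx.le, one_div_mul_cancel hν.ne', Real.rpow_one]
  have hx2 : x ^ ((ν - 1 / 2) / (1 - ν)) =
      (x ^ (1 / (1 - ν))) ^ ν / √(x ^ (1 / (1 - ν))) := by
    rw [Real.sqrt_eq_rpow, ← Real.rpow_sub hN, ← Real.rpow_mul hx.le]
    congr 1
    ring
  have hM := mainardiM_eq_integral hν0 hν1 hN
  rw [← hx1] at hM
  dsimp only [Function.comp_apply]
  rw [hM, hx2, hb]
  have := Real.sqrt_pos.2 hN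
  have := Real.rpow_pos_of_pos hN ν
  have := Real.pi_pos
  have := Real.exp_pos (-((1 - ν) / ν) * x ^ (1 / (1 - ν)))
  field_simp
end
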